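/- Let R be a one-dimensional Cohen–Macaulay local ring with canonical module K_R and let I be a faithful ideal of R. Suppose that I ⊗_R Hom_R(I, K_R) is torsionfree. If e(R) ≤ 6, then I ≅ R or I ≅ K_R as an R-module. -/

import Mathlib

open CategoryTheory TensorProduct

noncomputable section

/-- Minimal number of generators of a submodule. -/
def minGen (R : Type*) {M : Type*} [Semiring R] [AddCommMonoid M] [Module R M]
    (p : Submodule R M) : ℕ :=
  sInf {n | ∃ s : Finset M, s.card = n ∧ Submodule.span R (s : Set M) = p}

/-- Length of a module, as the height of `⊤` in its lattice of submodules. -/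
def moduleLength (R M : Type*) [Ring R] [AddCommGroup M] [Module R M] : ℕ∞ :=
  Order.height (⊤ : Submodule R M)

/-- `e` is the (Hilbert–Samuel) multiplicity of the one-dimensional local ring `(R, m)`:
the first difference of the Hilbert–Samuel function `n ↦ ℓ_R(R/mⁿ)` is eventually
equal to `e`. -/
def IsMultiplicityAt (R : Type*) [CommRing R] (m : Ideal R) (e : ℕ) : Prop :=
  ∃ N : ℕ, ∀ n ≥ N,
    moduleLength R (R ⧸ (m ^ (n + 1))) = moduleLength R (R ⧸ (m ^ n)) + e

/-- The `i`-th Ext module `Ext_R^i(M, N)`. -/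
def extMod (R : Type u) [CommRing R] (M N : ModuleCat.{u} R) (i : ℕ) : ModuleCat R :=
  ((Ext R (ModuleCat.{u} R) i).obj (Opposite.op M)).obj N

/-- `K` is a canonical module of the one-dimensional Cohen–Macaulay local ring `R` with
maximal ideal `m`, via the Bass-number characterization:
`Ext^i(R/m, K) = 0` for `i ≠ 1` and `Ext^1(R/m, K) ≅ R/m`. -/
def IsCanonicalModuleAt (R : Type u) [CommRing R] (m : Ideal R)
    (K : Type u) [AddCommGroup K] [Module R K] : Prop :=
  Module.Finite R K ∧
  (∀ i : ℕ, i ≠ 1 →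
    Subsingleton (extMod R (ModuleCat.of R (R ⧸ m)) (ModuleCat.of R K) i)) ∧
  Nonempty ((extMod R (ModuleCat.of R (R ⧸ m)) (ModuleCat.of R K) 1) ≅
    ModuleCat.of R (R ⧸ m))

/-- The evaluation map `I ⊗_R Hom_R(I, K) → K`, `x ⊗ f ↦ f x`. -/
def evalMap (R : Type*) [CommRing R] {M : Type*} [AddCommGroup M] [Module R M]
    (I : Submodule R M) (K : Type*) [AddCommGroup K] [Module R K] :
    (I ⊗[R] (I →ₗ[R] K)) →ₗ[R] K :=
  TensorProduct.lift LinearMap.applyₗ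

/-- A fractional ideal `I` of `R` with `FI = F`: a finitely generated `R`-submodule of the
total ring of fractions `F = Q(R)` containing a unit of `F`. -/
def IsFracIdealUnit (R : Type*) [CommRing R] (I : Submodule R (FractionRing R)) : Prop :=
  I.FG ∧ ∃ x ∈ I, IsUnit x

/-- A one-dimensional Cohen–Macaulay local ring: Noetherian, local, Krull dimension one,
and the maximal ideal contains a nonzerodivisor. -/
def IsOneDimCMLocal (R : Type*) [CommRing R] [IsLocalRing R] : Prop :=
  IsNoetherianRing R ∧ ringKrullDim R = 1 ∧
    ∃ x ∈ IsLocalRing.maximalIdeal R, x ∈ nonZeroDivisors R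

/-- The colon `M : N = {x ∈ A | x N ⊆ M}` of two `R`-submodules of an `R`-algebra `A`,
as an `R`-submodule of `A`. -/
def colonSub {R A : Type*} [CommRing R] [CommRing A] [Algebra R A]
    (M N : Submodule R A) : Submodule R A where
  carrier := {x : A | ∀ y ∈ N, x * y ∈ M}
  add_mem' := fun {a b} ha hb y hy => by
    rw [add_mul]; exact M.add_mem (ha y hy) (hb y hy)
  zero_mem' := fun y hy => by rw [zero_mul]; exact M.zero_mem
  smul_mem' := fun c {x} hx y hy => by
    rw [smul_mul_assoc]; exact M.smul_mem c (hx y hy)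


theorem exists_surjective_ker_of_homology_iso {R : Type u} [CommRing R]
    (S : ShortComplex (ModuleCat.{u} R)) {X : ModuleCat.{u} R} (e : S.homology ≅ X) :
    ∃ θ : LinearMap.ker S.g.hom →ₗ[R] X, Function.Surjective θ ∧
      ∀ z, θ z = 0 ↔ ∃ y, S.f.hom y = z := by
  let e' := S.moduleCatHomologyIso.symm ≪≫ e
  let q : LinearMap.ker S.g.hom →ₗ[R] X :=
    e'.toLinearEquiv.toLinearMap ∘ₗ (LinearMap.range S.moduleCatToCycles).mkQ
  refine ⟨q, e'.toLinearEquiv.surjective.comp (Submodule.mkQ_surjective _), fun z => ?_⟩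
  have : q z = 0 ↔ (LinearMap.range S.moduleCatToCycles).mkQ z = 0 :=
    e'.toLinearEquiv.map_eq_zero_iff
  rw [this, Submodule.mkQ_apply, Submodule.Quotient.mk_eq_zero, LinearMap.mem_range]
  simp only [Subtype.ext_iff]
  rfl

theorem exists_resolution_of_isCanonicalModuleAt {R : Type u} [CommRing R] {m : Ideal R}
    {K : Type u} [AddCommGroup K] [Module R K] (hK : IsCanonicalModuleAt R m K) :
    ∃ (P₀ P₁ P₂ P₃ : ModuleCat.{u} R) (d₁ : P₁ →ₗ[R] P₀) (d₂ : P₂ →ₗ[R] P₁)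
      (d₃ : P₃ →ₗ[R] P₂) (ε : P₀ →ₗ[R] R ⧸ m),
      Module.Projective R P₀ ∧ Module.Projective R P₁ ∧ Module.Projective R P₂ ∧
      Function.Surjective ε ∧ LinearMap.range d₁ = LinearMap.ker ε ∧
      LinearMap.range d₂ = LinearMap.ker d₁ ∧ d₂ ∘ₗ d₃ = 0 ∧
      (∀ f : P₀ →ₗ[R] K, f ∘ₗ d₁ = 0 → f = 0) ∧
      (∀ f : P₂ →ₗ[R] K, f ∘ₗ d₃ = 0 → ∃ g : P₁ →ₗ[R] K, f = g ∘ₗ d₂) ∧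
      ∃ θ : LinearMap.ker (LinearMap.lcomp R K d₂) →ₗ[R] R ⧸ m, Function.Surjective θ ∧
        ∀ z, θ z = 0 ↔ ∃ y : P₀ →ₗ[R] K, y ∘ₗ d₁ = (z : P₁ →ₗ[R] K) := by
  obtain ⟨-, hv, ⟨e⟩⟩ := hK
  let P := projectiveResolution (ModuleCat.of R (R ⧸ m))
  let Y := ModuleCat.of R K
  have hexact (n : ℕ) (hn : n ≠ 1) : (P.complex.linearYonedaObj R Y).ExactAt n := by
    rw [HomologicalComplex.exactAt_iff_isZero_homology]
    have : Subsingleton (((Ext R (ModuleCat.{u} R) n).obj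
      (Opposite.op (ModuleCat.of R (R ⧸ m)))).obj Y) := hv n hn
    exact Limits.IsZero.of_iso (ModuleCat.isZero_of_subsingleton _) (P.isoExt n Y).symm
  refine ⟨P.complex.X 0, P.complex.X 1, P.complex.X 2, P.complex.X 3, (P.complex.d 1 0).hom,
    (P.complex.d 2 1).hom, (P.complex.d 3 2).hom, (P.π.f 0).hom, ?_, ?_, ?_, ?_, ?_, ?_, ?_, ?_,
    ?_, ?_⟩
  · exact (IsProjective.iff_projective _).2 (P.projective 0)
  · exact (IsProjective.iff_projective _).2 (P.projective 1)
  · exact (IsProjective.iff_projective _).2 (P.projective 2)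
  · exact (ModuleCat.epi_iff_surjective _).1 inferInstance
  · exact (P.exact₀).moduleCat_range_eq_ker
  · exact (P.exact_succ 0).moduleCat_range_eq_ker
  · have := P.complex.d_comp_d 3 2 1
    exact congrArg ModuleCat.Hom.hom this
  · intro f hf
    have h := hexact 0 (by simp)
    rw [HomologicalComplex.exactAt_iff' _ 0 0 1 (by simp) (by simp),
      ShortComplex.moduleCat_exact_iff] at h
    obtain ⟨g, hg⟩ := h (ModuleCat.ofHom f) (by
      apply ModuleCat.hom_ext
      exact hf)
    have h0 : (P.complex.linearYonedaObj R Y).d 0 0 = 0 := HomologicalComplex.shape _ _ _ (by simp)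
    have h1 : ((P.complex.linearYonedaObj R Y).sc' 0 0 1).f = 0 := h0
    rw [h1] at hg
    exact (congrArg ModuleCat.Hom.hom hg).symm
  · intro f hf
    have h := hexact 2 (by simp)
    rw [HomologicalComplex.exactAt_iff' _ 1 2 3 (by simp) (by simp),
      ShortComplex.moduleCat_exact_iff] at h
    obtain ⟨g, hg⟩ := h (ModuleCat.ofHom f) (by
      apply ModuleCat.hom_ext
      exact hf)
    exact ⟨ModuleCat.Hom.hom g, (congrArg ModuleCat.Hom.hom hg).symm⟩
  · obtain ⟨θ, h1, h2⟩ := exists_surjective_ker_of_homology_iso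
      ((P.complex.linearYonedaObj R Y).sc' 0 1 2) (X := ModuleCat.of R (R ⧸ m))
      (ShortComplex.homologyMapIso ((P.complex.linearYonedaObj R Y).isoSc' 0 1 2 (by simp)
        (by simp)).symm ≪≫ (P.isoExt 1 Y).symm ≪≫ e)
    let κ : LinearMap.ker (LinearMap.lcomp R K (P.complex.d 2 1).hom) →ₗ[R]
        LinearMap.ker ((P.complex.linearYonedaObj R Y).sc' 0 1 2).g.hom :=
      { toFun := fun z => ⟨ModuleCat.ofHom z.1, ModuleCat.hom_ext (LinearMap.mem_ker.1 z.2)⟩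
        map_add' := fun _ _ => rfl
        map_smul' := fun _ _ => rfl }
    refine ⟨θ ∘ₗ κ, h1.comp fun z => ?_, fun z => (h2 (κ z)).trans ?_⟩
    · refine ⟨⟨ModuleCat.Hom.hom z.1, ?_⟩, ?_⟩
      · have hz := z.2
        exact congrArg ModuleCat.Hom.hom
          (show (P.complex.d 2 1 ≫ z.1 : P.complex.X 2 ⟶ Y) = 0 from hz)
      exact Subtype.ext (ModuleCat.hom_ext rfl)
    · exact ⟨fun ⟨y, hy⟩ => ⟨ModuleCat.Hom.hom y, congrArg ModuleCat.Hom.hom hy⟩,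
        fun ⟨y, hy⟩ => ⟨ModuleCat.ofHom y, ModuleCat.hom_ext hy⟩⟩

section

open IsLocalRing

open scoped Pointwise

theorem QuotSMulTop.mk_eq_zero_iff {R M : Type*} [CommRing R] [AddCommGroup M] [Module R M]
    {x : R} {u : M} : (Submodule.Quotient.mk u : QuotSMulTop x M) = 0 ↔ ∃ w : M, x • w = u := by
  rw [Submodule.Quotient.mk_eq_zero, Submodule.mem_smul_pointwise_iff_exists]
  simp

/-- Division by a regular element `x` of a linear map with values in `x • K`. -/
theorem exists_smul_eq_of_forall_exists {R P K : Type*} [CommRing R] [AddCommGroup P] [Module R P]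
    [AddCommGroup K] [Module R K] {x : R} (hx : IsSMulRegular K x) (f : P →ₗ[R] K)
    (h : ∀ p, ∃ w, x • w = f p) : ∃ g : P →ₗ[R] K, f = x • g := by
  choose g hg using h
  refine ⟨⟨⟨g, fun p q => hx ?_⟩, fun c p => hx ?_⟩, ?_⟩
  · simp [hg]
  · simp only [hg, map_smul, RingHom.id_apply]
    rw [smul_comm, hg]
  · ext p
    exact (hg p).symm

section CanonicalModule

variable {R : Type u} [CommRing R] [IsLocalRing R] {K : Type u} [AddCommGroup K] [Module R K]

theorem exists_section_of_isLocalRing {P : Type u} [AddCommGroup P] [Module R P]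
    [Module.Projective R P] {ε : P →ₗ[R] R ⧸ maximalIdeal R} (hε : Function.Surjective ε) :
    ∃ (ρ : P →ₗ[R] R) (s : P), (∀ p, ε p = Submodule.Quotient.mk (ρ p)) ∧ IsUnit (ρ s) ∧
      ∀ y ∈ maximalIdeal R, y • s ∈ LinearMap.ker ε := by
  obtain ⟨ρ, hρ⟩ := Module.projective_lifting_property (maximalIdeal R).mkQ ε
    (Submodule.mkQ_surjective _)
  have hρ' : ∀ p, ε p = Submodule.Quotient.mk (ρ p) := fun p => by rw [← hρ]; rfl
  obtain ⟨s, hs⟩ := hε (Submodule.Quotient.mk 1)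
  refine ⟨ρ, s, hρ', ?_, fun y hy => ?_⟩
  · rw [hρ', Submodule.Quotient.eq] at hs
    by_contra h
    have h1 : ρ s ∈ maximalIdeal R := h
    have h2 : (1 : R) ∈ maximalIdeal R := by
      simpa only [sub_sub_cancel] using sub_mem h1 hs
    exact (Ideal.ne_top_iff_one _).1 (maximalIdeal.isMaximal R).ne_top h2
  · rw [LinearMap.mem_ker, map_smul, hs, ← Submodule.Quotient.mk_smul,
      Submodule.Quotient.mk_eq_zero]
    simpa using hy

theorem IsCanonicalModuleAt.eq_zero_of_forall_smul_eq_zero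
    (hK : IsCanonicalModuleAt R (maximalIdeal R) K) {u : K}
    (hu : ∀ y ∈ maximalIdeal R, y • u = 0) : u = 0 := by
  obtain ⟨P₀, P₁, P₂, P₃, d₁, d₂, d₃, ε, _, _, _, hε, h1, h2, h3, hE0, -⟩ :=
    exists_resolution_of_isCanonicalModuleAt hK
  let f : (R ⧸ maximalIdeal R) →ₗ[R] K := Submodule.liftQ _ (LinearMap.toSpanSingleton R K u) hu
  have hf := hE0 (f ∘ₗ ε) (by
    rw [LinearMap.comp_assoc, LinearMap.range_le_ker_iff.1 h1.le, LinearMap.comp_zero])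
  obtain ⟨s, hs⟩ := hε (Submodule.Quotient.mk 1)
  have h := LinearMap.congr_fun hf s
  rw [LinearMap.comp_apply, hs] at h
  exact (one_smul R u).symm.trans h

theorem IsCanonicalModuleAt.nontrivial (hK : IsCanonicalModuleAt R (maximalIdeal R) K) :
    Nontrivial K := by
  obtain ⟨P₀, P₁, P₂, P₃, d₁, d₂, d₃, ε, _, _, _, hε, h1, h2, h3, -, -, θ, hθ, -⟩ :=
    exists_resolution_of_isCanonicalModuleAt hK
  by_contra h
  rw [not_nontrivial_iff_subsingleton] at h
  have : Subsingleton (LinearMap.ker (LinearMap.lcomp R K d₂)) :=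
    ⟨fun a b => Subtype.ext (LinearMap.ext fun p => Subsingleton.elim _ _)⟩
  exact not_subsingleton (R ⧸ maximalIdeal R) hθ.subsingleton

theorem IsCanonicalModuleAt.exists_smul_eq_of_socle
    (hK : IsCanonicalModuleAt R (maximalIdeal R) K) {x : R}
    (hx : IsSMulRegular K x) (u v : QuotSMulTop x K)
    (hu : ∀ y ∈ maximalIdeal R, y • u = 0) (hv : ∀ y ∈ maximalIdeal R, y • v = 0) :
    ∃ c : R, u = c • v ∨ v = c • u := by
  obtain ⟨P₀, P₁, P₂, P₃, d₁, d₂, d₃, ε, _, _, _, hε, h1, h2, h3, -, -, θ, hθ, hθ0⟩ :=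
    exists_resolution_of_isCanonicalModuleAt hK
  obtain ⟨ρ, s, hρ, hunit, hs⟩ := exists_section_of_isLocalRing hε
  have hρd (p) : ρ (d₁ p) ∈ maximalIdeal R := by
    have : d₁ p ∈ LinearMap.ker ε := h1 ▸ LinearMap.mem_range_self d₁ p
    rw [LinearMap.mem_ker, hρ, Submodule.Quotient.mk_eq_zero] at this
    exact this
  obtain ⟨u, rfl⟩ := Submodule.Quotient.mk_surjective _ u
  obtain ⟨v, rfl⟩ := Submodule.Quotient.mk_surjective _ v
  have cocycle (u : K) (hu : ∀ y ∈ maximalIdeal R,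
      y • (Submodule.Quotient.mk u : QuotSMulTop x K) = 0) :
      ∃ z : LinearMap.ker (LinearMap.lcomp R K d₂), ∀ p, x • z.1 p = ρ (d₁ p) • u := by
    obtain ⟨g, hg⟩ := exists_smul_eq_of_forall_exists hx
      (LinearMap.toSpanSingleton R K u ∘ₗ ρ ∘ₗ d₁) (fun p => by
        have := hu _ (hρd p)
        rwa [← Submodule.Quotient.mk_smul, QuotSMulTop.mk_eq_zero_iff] at this)
    have hg' (p) : x • g p = ρ (d₁ p) • u := (LinearMap.congr_fun hg p).symm
    refine ⟨⟨g, LinearMap.mem_ker.2 (LinearMap.ext fun p => hx ?_)⟩, hg'⟩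
    have : d₁ (d₂ p) = 0 := by
      rw [← LinearMap.mem_ker, ← h2]
      exact LinearMap.mem_range_self d₂ p
    simp [hg', this]
  obtain ⟨zu, hzu⟩ := cocycle u hu
  obtain ⟨zv, hzv⟩ := cocycle v hv
  have key (α β : R) (h : θ (α • zu + β • zv) = 0) :
      (Submodule.Quotient.mk (α • u + β • v) : QuotSMulTop x K) = 0 := by
    obtain ⟨w, hw⟩ := (hθ0 _).1 h
    have hsoc : ρ s • (α • u + β • v) - x • w s = 0 := by
      refine hK.eq_zero_of_forall_smul_eq_zero fun y hy => ?_
      obtain ⟨p, hp⟩ := h1.symm ▸ hs y hy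
      have e1 : y • w s = α • zu.1 p + β • zv.1 p := by
        rw [← map_smul, ← hp]
        exact LinearMap.congr_fun hw p
      have e2 : ρ (d₁ p) = y * ρ s := by simp [hp]
      rw [smul_sub, smul_comm y x, e1, smul_add x, smul_comm x α, smul_comm x β, hzu, hzv, e2]
      module
    rw [sub_eq_zero] at hsoc
    rw [QuotSMulTop.mk_eq_zero_iff]
    obtain ⟨t, ht⟩ := hunit
    refine ⟨(↑t⁻¹ : R) • w s, ?_⟩
    rw [smul_comm, ← hsoc, ← ht, smul_smul, Units.inv_mul, one_smul]
  let _ := Ideal.Quotient.field (maximalIdeal R)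
  by_cases h0 : θ zv = 0
  · refine ⟨0, Or.inr ?_⟩
    have := key 0 1 (by simp [h0])
    simpa using this
  · obtain ⟨c, hc⟩ := Ideal.Quotient.mk_surjective (θ zu / θ zv)
    refine ⟨c, Or.inl ?_⟩
    have := key 1 (-c) (by
      rw [map_add, map_smul, map_smul, neg_smul, one_smul, Algebra.smul_def,
        Ideal.Quotient.algebraMap_eq, hc, div_mul_cancel₀ _ h0, add_neg_cancel])
    rw [one_smul, neg_smul, ← sub_eq_add_neg, Submodule.Quotient.mk_sub, sub_eq_zero] at this
    exact this

theorem IsCanonicalModuleAt.exists_eq_smul_of_apply_eq_zero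
    (hK : IsCanonicalModuleAt R (maximalIdeal R) K) {x : R} (hxm : x ∈ maximalIdeal R)
    (hx : IsSMulRegular K x) (φ : maximalIdeal R →ₗ[R] QuotSMulTop x K)
    (hφ : φ ⟨x, hxm⟩ = 0) : ∃ w : QuotSMulTop x K, ∀ y, φ y = (y : R) • w := by
  obtain ⟨P₀, P₁, P₂, P₃, d₁, d₂, d₃, ε, _, _, _, hε, h1, h2, h3, -, hE2, -⟩ :=
    exists_resolution_of_isCanonicalModuleAt hK
  obtain ⟨ρ, s, hρ, hunit, hs⟩ := exists_section_of_isLocalRing hε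
  have hρd (p) : (ρ ∘ₗ d₁) p ∈ maximalIdeal R := by
    have : d₁ p ∈ LinearMap.ker ε := h1 ▸ LinearMap.mem_range_self d₁ p
    rw [LinearMap.mem_ker, hρ, Submodule.Quotient.mk_eq_zero] at this
    exact this
  have hd (p) : d₁ (d₂ p) = 0 := by
    rw [← LinearMap.mem_ker, ← h2]
    exact LinearMap.mem_range_self d₂ p
  obtain ⟨g₀, hg₀⟩ := Module.projective_lifting_property
    (Submodule.mkQ (x • (⊤ : Submodule R K)))
    (φ ∘ₗ LinearMap.codRestrict (maximalIdeal R) (ρ ∘ₗ d₁) hρd) (Submodule.mkQ_surjective _)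
  have hg₀' (p) : (Submodule.Quotient.mk (g₀ p) : QuotSMulTop x K) = φ ⟨_, hρd p⟩ :=
    LinearMap.congr_fun hg₀ p
  obtain ⟨c, hc⟩ := exists_smul_eq_of_forall_exists hx (g₀ ∘ₗ d₂) (fun p => by
    rw [← QuotSMulTop.mk_eq_zero_iff, LinearMap.comp_apply, hg₀']
    convert map_zero φ
    simp [hd])
  obtain ⟨b, hb⟩ := hE2 c (LinearMap.ext fun p => hx (by
    have e1 := LinearMap.congr_fun hc (d₃ p)
    have e2 : d₂ (d₃ p) = 0 := LinearMap.congr_fun h3 p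
    simp only [LinearMap.comp_apply, LinearMap.smul_apply, e2, map_zero] at e1 ⊢
    simp [← e1]))
  let g := g₀ - x • b
  have hgd (p) : g (d₂ p) = 0 := by
    have e1 := LinearMap.congr_fun hc p
    have e2 := LinearMap.congr_fun hb p
    simp only [LinearMap.comp_apply, LinearMap.smul_apply] at e1 e2
    simp [g, e1, e2]
  have hgker (p) (hp : d₁ p = 0) : g p = 0 := by
    obtain ⟨q, rfl⟩ : p ∈ LinearMap.range d₂ := h2 ▸ hp
    exact hgd q
  have hg (p) : (Submodule.Quotient.mk (g p) : QuotSMulTop x K) = φ ⟨_, hρd p⟩ := by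
    rw [← hg₀', ← sub_eq_zero, ← Submodule.Quotient.mk_sub, QuotSMulTop.mk_eq_zero_iff]
    exact ⟨- b p, by simp [g]⟩
  have hlift (y : maximalIdeal R) (p) (hp : d₁ p = (y : R) • s) :
      (Submodule.Quotient.mk (g p) : QuotSMulTop x K) = ρ s • φ y := by
    rw [hg, ← map_smul]
    congr 1
    ext
    simp [hp, mul_comm]
  obtain ⟨p, hp⟩ := h1.symm ▸ hs x hxm
  obtain ⟨w, hw⟩ := QuotSMulTop.mk_eq_zero_iff.1
    ((hlift ⟨x, hxm⟩ p hp).trans (by rw [hφ, smul_zero]))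
  obtain ⟨t, ht⟩ := hunit
  refine ⟨(↑t⁻¹ : R) • Submodule.Quotient.mk w, fun y => ?_⟩
  obtain ⟨q, hq⟩ := h1.symm ▸ hs y y.2
  have e1 : g q = (y : R) • w := by
    refine hx ?_
    have := hgker (x • q - (y : R) • p) (by
      rw [map_sub, map_smul, map_smul, hp, hq, smul_comm, sub_self])
    rw [map_sub, map_smul, map_smul, sub_eq_zero] at this
    simp only [this, ← hw, smul_comm x]
  have e2 := hlift y q hq
  rw [e1, ← ht] at e2
  rw [smul_comm, ← Submodule.Quotient.mk_smul, e2, smul_smul, Units.inv_mul, one_smul]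

end CanonicalModule

theorem exists_ne_zero_forall_smul_eq_zero {R M : Type*} [CommRing R] [IsLocalRing R]
    [AddCommGroup M] [Module R M] [IsArtinian R M] [Nontrivial M] :
    ∃ z : M, z ≠ 0 ∧ ∀ y ∈ maximalIdeal R, y • z = 0 := by
  obtain ⟨N, hN⟩ := IsAtomic.exists_atom (Submodule R M)
  have : IsSimpleModule R N := isSimpleModule_iff_isAtom.2 hN
  have := IsSimpleModule.nontrivial R N
  obtain ⟨z, hz⟩ := exists_ne (0 : N)
  have hm := eq_maximalIdeal (IsSimpleModule.annihilator_isMaximal (R := R) (M := N))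
  refine ⟨z, by simpa using hz, fun y hy => ?_⟩
  rw [← hm, Module.mem_annihilator] at hy
  exact congrArg Subtype.val (hy z)

theorem isFiniteLength_quotSMulTop {R : Type*} (M : Type*) [CommRing R] [AddCommGroup M]
    [Module R M] [Module.Finite R M] {x : R} (hx : IsFiniteLength R (R ⧸ Ideal.span {x})) :
    IsFiniteLength R (QuotSMulTop x M) := by
  obtain ⟨n, f, hf⟩ := Module.Finite.exists_fin' R M
  have h := (Module.length_ne_top_iff (R := R) (M := R ⧸ Ideal.span {x})).2 hx
  have h1 : Module.length R ((R ⧸ Ideal.span {x}) ⊗[R] (Fin n → R)) ≠ ⊤ := by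
    rw [(TensorProduct.piScalarRight R R (R ⧸ Ideal.span {x}) (Fin n)).length_eq,
      Module.length_pi]
    exact WithTop.mul_ne_top (by rw [ENat.card_eq_coe_fintype_card]; exact ENat.natCast_ne_top _) h
  rw [← Module.length_ne_top_iff, (QuotSMulTop.equivQuotTensor x M).length_eq]
  exact ne_top_of_le_ne_top h1 (Module.length_le_of_surjective _
    (LinearMap.lTensor_surjective _ hf))

theorem Module.length_le_length_ker_add_length {R M N : Type*} [CommRing R] [AddCommGroup M]
    [Module R M] [AddCommGroup N] [Module R N] (f : M →ₗ[R] N) :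
    Module.length R M ≤ Module.length R (LinearMap.ker f) + Module.length R N := by
  rw [Module.length_eq_add_of_exact (LinearMap.ker f).subtype f.rangeRestrict
    (Submodule.injective_subtype _) f.surjective_rangeRestrict (by
      rw [LinearMap.exact_iff, LinearMap.ker_rangeRestrict, Submodule.range_subtype])]
  gcongr
  exact Module.length_le_of_injective _ (Submodule.injective_subtype _)

theorem Module.length_le_one_of_forall_exists_smul_eq {R M : Type*} [CommRing R] [IsLocalRing R]
    [AddCommGroup M] [Module R M] (h0 : ∀ y ∈ maximalIdeal R, ∀ u : M, y • u = 0)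
    (h : ∀ u v : M, ∃ c : R, u = c • v ∨ v = c • u) : Module.length R M ≤ 1 := by
  rcases subsingleton_or_nontrivial M with hM | hM
  · simp
  · refine (Module.length_eq_one_iff.2 ?_).le
    rw [isSimpleModule_iff_toSpanSingleton_surjective]
    refine ⟨hM, fun u hu v => ?_⟩
    obtain ⟨c, hc | hc⟩ := h u v
    · by_cases hcm : c ∈ maximalIdeal R
      · exact absurd (hc.trans (h0 c hcm v)) hu
      · obtain ⟨c, rfl⟩ : IsUnit c := by simpa using hcm
        refine ⟨(↑c⁻¹ : R), ?_⟩
        rw [LinearMap.toSpanSingleton_apply, hc, smul_smul, Units.inv_mul, one_smul]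
    · exact ⟨c, hc.symm⟩

theorem LinearMap.exists_extend_sup_span_singleton {R P E : Type*} [CommRing R] [AddCommGroup P]
    [Module R P] [AddCommGroup E] [Module R E] (f : P →ₗ.[R] E) (z : P) (w : E)
    (h : ∀ (c : R) (hc : c • z ∈ f.domain), f ⟨c • z, hc⟩ = c • w) :
    ∃ g : P →ₗ.[R] E, f ≤ g ∧ ∃ hz : z ∈ g.domain, g ⟨z, hz⟩ = w := by
  have H : ∀ c : R, c • z = 0 → c • w = 0 := fun c hc => by
    rw [← h c (hc ▸ f.domain.zero_mem)]
    exact (congrArg f (Subtype.ext hc)).trans f.map_zero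
  let q : P →ₗ.[R] E := LinearPMap.mkSpanSingleton' (σ := RingHom.id R) z w H
  have H' : ∀ (x : f.domain) (y : q.domain),
      (x : P) = y → f x = q y := by
    rintro ⟨x, hx⟩ ⟨y, hy⟩ (rfl : x = y)
    obtain ⟨c, rfl⟩ := Submodule.mem_span_singleton.1 hy
    rw [h]
    exact (LinearPMap.mkSpanSingleton'_apply (σ := RingHom.id R) z w H c hy).symm
  have hz : z ∈ q.domain := Submodule.mem_span_singleton_self z
  refine ⟨f.sup _ H', f.left_le_sup _ _, (f.right_le_sup _ H').1 hz, ?_⟩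
  rw [← (f.right_le_sup _ H').2 (x := ⟨z, hz⟩) rfl]
  exact LinearPMap.mkSpanSingleton'_apply_self (σ := RingHom.id R) z w H hz

section CanonicalModule

variable {R : Type u} [CommRing R] [IsLocalRing R] {K : Type u} [AddCommGroup K] [Module R K]

/-- Injectivity of `K / xK` with respect to inclusions of modules that contain `x • P`. -/
theorem IsCanonicalModuleAt.exists_extend (hK : IsCanonicalModuleAt R (maximalIdeal R) K) {x : R}
    (hxm : x ∈ maximalIdeal R) (hx : IsSMulRegular K x) {P : Type*} [AddCommGroup P] [Module R P]
    [IsNoetherian R P] (hP : IsFiniteLength R (QuotSMulTop x P))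
    (f : P →ₗ.[R] QuotSMulTop x K) (hf : ∀ p, ∃ h : x • p ∈ f.domain, f ⟨x • p, h⟩ = 0) :
    ∃ g : P →ₗ[R] QuotSMulTop x K, ∀ n : f.domain, g n = f n := by
  obtain ⟨N, hN⟩ : ∃ N, f.domain = N := ⟨_, rfl⟩
  induction N using WellFoundedGT.induction generalizing f with
  | ind N ih =>
    by_cases htop : f.domain = ⊤
    · exact ⟨f.toFun ∘ₗ (LinearMap.id.codRestrict f.domain fun p => htop ▸ Submodule.mem_top),
        fun n => rfl⟩
    have hle : x • (⊤ : Submodule R P) ≤ f.domain := by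
      intro p hp
      obtain ⟨q, -, rfl⟩ := (Submodule.mem_smul_pointwise_iff_exists _ _ _).1 hp
      exact (hf q).1
    have hfin : IsFiniteLength R (P ⧸ f.domain) :=
      hP.of_surjective (f := Submodule.factor hle) (Submodule.factor_surjective hle)
    have := (isFiniteLength_iff_isNoetherian_isArtinian.1 hfin).2
    have : Nontrivial (P ⧸ f.domain) := Submodule.Quotient.nontrivial_iff.2 htop
    obtain ⟨z, hz0, hz⟩ := exists_ne_zero_forall_smul_eq_zero (R := R) (M := P ⧸ f.domain)
    obtain ⟨z, rfl⟩ := Submodule.Quotient.mk_surjective _ z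
    rw [Ne, Submodule.Quotient.mk_eq_zero] at hz0
    simp_rw [← Submodule.Quotient.mk_smul, Submodule.Quotient.mk_eq_zero] at hz
    obtain ⟨w, hw⟩ := hK.exists_eq_smul_of_apply_eq_zero hxm hx
      (f.toFun ∘ₗ ((LinearMap.toSpanSingleton R P z ∘ₗ (maximalIdeal R).subtype).codRestrict
        f.domain fun y => hz y y.2)) (hf z).2
    obtain ⟨g, hfg, hzg, -⟩ := LinearMap.exists_extend_sup_span_singleton f z w (fun c hc => by
      have hcm : c ∈ maximalIdeal R := by
        by_contra hcm
        obtain ⟨c, rfl⟩ : IsUnit c := by simpa using hcm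
        refine hz0 ?_
        have := f.domain.smul_mem (↑c⁻¹ : R) hc
        rwa [smul_smul, Units.inv_mul, one_smul] at this
      exact hw ⟨c, hcm⟩)
    obtain ⟨F, hF⟩ := ih g.domain (by
      rw [← hN]
      exact lt_of_le_of_ne hfg.1 (fun h => hz0 (h ▸ hzg))) g (fun p =>
        ⟨hfg.1 (hf p).1, by rw [← (hf p).2]; exact (hfg.2 rfl).symm⟩) rfl
    exact ⟨F, fun n => (hF ⟨n, hfg.1 n.2⟩).trans (hfg.2 rfl).symm⟩

variable [IsNoetherianRing R] [Ring.KrullDimLE 1 R]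

theorem IsCanonicalModuleAt.isSMulRegular (hK : IsCanonicalModuleAt R (maximalIdeal R) K) {x : R}
    (hx : x ∈ nonZeroDivisors R) : IsSMulRegular K x := by
  have := hK.1
  rw [isSMulRegular_iff_right_eq_zero_of_smul]
  by_contra! h
  obtain ⟨u, hu, hu0⟩ := h
  let N := Submodule.torsionBy R K x
  have : Nontrivial N := ⟨⟨⟨u, hu⟩, 0, fun h => hu0 (congrArg Subtype.val h)⟩⟩
  have hN := isFiniteLength_quotSMulTop N (isFiniteLength_quotient_span_singleton R hx)
  have h0 : x • (⊤ : Submodule R N) = ⊥ := by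
    rw [eq_bot_iff]
    intro p hp
    obtain ⟨q, -, rfl⟩ := (Submodule.mem_smul_pointwise_iff_exists _ _ _).1 hp
    exact Subtype.ext q.2
  have := (isFiniteLength_iff_isNoetherian_isArtinian.1
    (hN.of_injective (f := (Submodule.quotEquivOfEqBot _ h0).symm.toLinearMap)
      (LinearEquiv.injective _))).2
  obtain ⟨z, hz0, hz⟩ := exists_ne_zero_forall_smul_eq_zero (R := R) (M := N)
  exact hz0 (Subtype.ext (hK.eq_zero_of_forall_smul_eq_zero fun y hy =>
    congrArg Subtype.val (hz y hy)))

theorem IsCanonicalModuleAt.exists_lift_of_mem (hK : IsCanonicalModuleAt R (maximalIdeal R) K)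
    {x : R} (hxm : x ∈ maximalIdeal R) (hx : x ∈ nonZeroDivisors R) {I : Ideal R} (hxI : x ∈ I)
    (f : I →ₗ[R] QuotSMulTop x K) :
    ∃ g : I →ₗ[R] K, ∀ i, Submodule.Quotient.mk (g i) = f i := by
  have hxK := hK.isSMulRegular hx
  have hx2 : x ^ 2 ∈ nonZeroDivisors R := pow_mem hx 2
  let μ : QuotSMulTop x K →ₗ[R] QuotSMulTop (x ^ 2) K :=
    Submodule.mapQ _ _ (LinearMap.lsmul R K x) (by
      intro p hp
      obtain ⟨q, -, rfl⟩ := (Submodule.mem_smul_pointwise_iff_exists _ _ _).1 hp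
      refine (Submodule.mem_smul_pointwise_iff_exists _ _ _).2 ⟨q, trivial, ?_⟩
      simp [pow_two, mul_smul])
  let f₂ : R →ₗ.[R] QuotSMulTop (x ^ 2) K := ⟨I, μ ∘ₗ f⟩
  obtain ⟨g, hg⟩ := hK.exists_extend (Ideal.pow_mem_of_mem _ hxm 2 two_pos)
    (hK.isSMulRegular hx2) (isFiniteLength_quotSMulTop R
      (isFiniteLength_quotient_span_singleton R hx2)) f₂ (fun p => by
      have h : x ^ 2 • p ∈ I := by
        rw [pow_two, mul_smul]
        exact I.mul_mem_right _ hxI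
      refine ⟨h, ?_⟩
      have e : (⟨x ^ 2 • p, h⟩ : I) = x • (⟨x * p, I.mul_mem_right _ hxI⟩ : I) := by
        ext
        simp [pow_two, mul_assoc]
      change μ (f _) = 0
      rw [e, map_smul]
      have := Module.mem_annihilator.1 (QuotSMulTop.mem_annihilator (M := K) x)
      rw [this, map_zero])
  obtain ⟨w, hw⟩ := Submodule.Quotient.mk_surjective _ (g 1)
  have key (i : I) : ∃ k : K, Submodule.Quotient.mk k = f i ∧ x • k = (i : R) • w := by
    obtain ⟨k, hk⟩ := Submodule.Quotient.mk_surjective _ (f i)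
    have e1 : g i = μ (f i) := hg i
    have e2 : (i : R) • g 1 = g i := by rw [← map_smul, smul_eq_mul, mul_one]
    rw [← e2, ← hw, ← hk, ← Submodule.Quotient.mk_smul] at e1
    change _ = Submodule.Quotient.mk (x • k) at e1
    rw [← sub_eq_zero, ← Submodule.Quotient.mk_sub, QuotSMulTop.mk_eq_zero_iff] at e1
    obtain ⟨t, ht⟩ := e1
    refine ⟨k + x • t, ?_, ?_⟩
    · rw [Submodule.Quotient.mk_add, hk, QuotSMulTop.mk_eq_zero_iff.2 ⟨t, rfl⟩, add_zero]
    · rw [smul_add, smul_smul, ← pow_two, ht, add_sub_cancel]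
  obtain ⟨F, hF⟩ := exists_smul_eq_of_forall_exists hxK
    (LinearMap.toSpanSingleton R K w ∘ₗ I.subtype) (fun i => (key i).imp fun k hk => hk.2)
  refine ⟨F, fun i => ?_⟩
  obtain ⟨k, hk, hk'⟩ := key i
  rw [← hk]
  congr 1
  refine hxK ?_
  have := LinearMap.congr_fun hF i
  exact this.symm.trans hk'.symm

omit [IsNoetherianRing R] [Ring.KrullDimLE 1 R] in
theorem IsCanonicalModuleAt.nontrivial_quotSMulTop
    (hK : IsCanonicalModuleAt R (maximalIdeal R) K) {x : R} (hxm : x ∈ maximalIdeal R) :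
    Nontrivial (QuotSMulTop x K) := by
  have := hK.1
  have := hK.nontrivial
  refine Submodule.Quotient.nontrivial_iff.2 fun h => ?_
  refine top_ne_bot (α := Submodule R K) (Submodule.eq_bot_of_le_smul_of_le_jacobson_bot
    (maximalIdeal R) ⊤ Module.Finite.fg_top ?_ (maximalIdeal_le_jacobson _))
  intro p hp
  rw [← h] at hp
  obtain ⟨q, -, rfl⟩ := (Submodule.mem_smul_pointwise_iff_exists _ _ _).1 hp
  exact Submodule.smul_mem_smul hxm trivial

theorem IsCanonicalModuleAt.exists_socle_quotSMulTop
    (hK : IsCanonicalModuleAt R (maximalIdeal R) K) {x : R} (hxm : x ∈ maximalIdeal R)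
    (hx : x ∈ nonZeroDivisors R) :
    ∃ w : QuotSMulTop x K, w ≠ 0 ∧ ∀ y ∈ maximalIdeal R, y • w = 0 := by
  have := hK.1
  have := hK.nontrivial_quotSMulTop hxm
  have := (isFiniteLength_iff_isNoetherian_isArtinian.1
    (isFiniteLength_quotSMulTop K (isFiniteLength_quotient_span_singleton R hx))).2
  exact exists_ne_zero_forall_smul_eq_zero

/-- A nonzero element of `I / xI` can be sent to any prescribed socle element of `K / xK`. -/
theorem IsCanonicalModuleAt.exists_apply_eq_of_ne_zero
    (hK : IsCanonicalModuleAt R (maximalIdeal R) K) {x : R} (hxm : x ∈ maximalIdeal R)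
    (hx : x ∈ nonZeroDivisors R) {I : Ideal R} (hxI : x ∈ I) {i : I}
    (hi : (Submodule.Quotient.mk i : QuotSMulTop x I) ≠ 0)
    {w : QuotSMulTop x K} (hw : ∀ y ∈ maximalIdeal R, y • w = 0) :
    ∃ f : I →ₗ[R] K, Submodule.Quotient.mk (f i) = w := by
  have hxK := hK.isSMulRegular hx
  let f₀ : I →ₗ.[R] QuotSMulTop x K := ⟨x • ⊤, 0⟩
  obtain ⟨g, hfg, hig, hg⟩ := LinearMap.exists_extend_sup_span_singleton f₀ i w (fun c hc => by
    have hcm : c ∈ maximalIdeal R := by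
      by_contra hcm
      obtain ⟨c, rfl⟩ : IsUnit c := by simpa using hcm
      refine hi ((Submodule.Quotient.mk_eq_zero _).2 ?_)
      have := f₀.domain.smul_mem (↑c⁻¹ : R) hc
      rwa [smul_smul, Units.inv_mul, one_smul] at this
    exact (hw c hcm).symm)
  have hmem (p : I) : x • p ∈ f₀.domain :=
    (Submodule.mem_smul_pointwise_iff_exists _ _ _).2 ⟨p, trivial, rfl⟩
  obtain ⟨F, hF⟩ := hK.exists_extend hxm hxK
    (isFiniteLength_quotSMulTop I (isFiniteLength_quotient_span_singleton R hx)) g (fun p =>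
      ⟨hfg.1 (hmem p), (hfg.2 (x := ⟨x • p, hmem p⟩) rfl).symm⟩)
  obtain ⟨f, hf⟩ := hK.exists_lift_of_mem hxm hx hxI F
  exact ⟨f, by rw [hf, ← hg]; exact hF ⟨i, hig⟩⟩

/-- `K / xK` cogenerates `I / xI`. -/
theorem IsCanonicalModuleAt.exists_apply_ne_zero
    (hK : IsCanonicalModuleAt R (maximalIdeal R) K) {x : R} (hxm : x ∈ maximalIdeal R)
    (hx : x ∈ nonZeroDivisors R) {I : Ideal R} (hxI : x ∈ I) {i : I}
    (hi : (Submodule.Quotient.mk i : QuotSMulTop x I) ≠ 0) :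
    ∃ f : I →ₗ[R] K, (Submodule.Quotient.mk (f i) : QuotSMulTop x K) ≠ 0 := by
  obtain ⟨w, hw0, hw⟩ := hK.exists_socle_quotSMulTop hxm hx
  obtain ⟨f, hf⟩ := hK.exists_apply_eq_of_ne_zero hxm hx hxI hi hw
  exact ⟨f, hf ▸ hw0⟩

omit [IsNoetherianRing R] [Ring.KrullDimLE 1 R] in
theorem IsCanonicalModuleAt.length_linearMap_le
    (hK : IsCanonicalModuleAt R (maximalIdeal R) K) {x : R} (hx : IsSMulRegular K x)
    {N : Type*} [AddCommGroup N] [Module R N] (hN : IsFiniteLength R N) :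
    Module.length R (N →ₗ[R] QuotSMulTop x K) ≤ Module.length R N := by
  induction hN with
  | of_subsingleton => simp
  | @of_simple_quotient M _ _ N _ _ ih =>
    have hlen : Module.length R M = Module.length R N + 1 := by
      rw [← Module.length_eq_one R (M ⧸ N)]
      exact Module.length_eq_add_of_exact N.subtype N.mkQ (Submodule.injective_subtype _)
        (Submodule.mkQ_surjective _) (LinearMap.exact_subtype_mkQ N)
    refine (Module.length_le_length_ker_add_length
      (LinearMap.lcomp R (QuotSMulTop x K) N.subtype)).trans ?_
    rw [hlen, add_comm]
    gcongr
    have hm := eq_maximalIdeal (IsSimpleModule.annihilator_isMaximal (R := R) (M := M ⧸ N))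
    have : Nontrivial (M ⧸ N) := IsSimpleModule.nontrivial R _
    obtain ⟨z, hz⟩ := exists_ne (0 : M ⧸ N)
    have hspan := IsSimpleModule.toSpanSingleton_surjective R hz
    obtain ⟨z, rfl⟩ := Submodule.Quotient.mk_surjective _ z
    have hker (f : LinearMap.ker (LinearMap.lcomp R (QuotSMulTop x K) N.subtype)) (p : M)
        (hp : (Submodule.Quotient.mk p : M ⧸ N) = 0) : f.1 p = 0 :=
      LinearMap.congr_fun f.2 ⟨p, (Submodule.Quotient.mk_eq_zero _).1 hp⟩
    have hkill (y) (hy : y ∈ maximalIdeal R)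
        (f : LinearMap.ker (LinearMap.lcomp R (QuotSMulTop x K) N.subtype)) (p : M) :
        y • f.1 p = 0 := by
      rw [← map_smul]
      refine hker f _ ?_
      rw [Submodule.Quotient.mk_smul]
      exact Module.mem_annihilator.1 (hm ▸ hy) _
    have hext (f g : LinearMap.ker (LinearMap.lcomp R (QuotSMulTop x K) N.subtype))
        (h : f.1 z = g.1 z) : f = g := by
      ext p
      obtain ⟨r, hr⟩ := hspan (Submodule.Quotient.mk p)
      have h0 : (Submodule.Quotient.mk (p - r • z) : M ⧸ N) = 0 := by
        rw [Submodule.Quotient.mk_sub, sub_eq_zero, ← hr]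
        rfl
      have e1 := hker f _ h0
      have e2 := hker g _ h0
      rw [map_sub, sub_eq_zero, map_smul] at e1 e2
      rw [e1, e2, h]
    refine Module.length_le_one_of_forall_exists_smul_eq (fun y hy f => hext _ _ ?_)
      fun f g => ?_
    · exact hkill y hy f z
    · obtain ⟨c, hc⟩ := hK.exists_smul_eq_of_socle hx (f.1 z) (g.1 z)
        (fun y hy => hkill y hy f z) (fun y hy => hkill y hy g z)
      exact ⟨c, hc.imp (fun h => hext _ _ h) (fun h => hext _ _ h)⟩

theorem IsCanonicalModuleAt.length_quotSMulTop_le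
    (hK : IsCanonicalModuleAt R (maximalIdeal R) K) {x : R} (hx : x ∈ nonZeroDivisors R) :
    Module.length R (QuotSMulTop x K) ≤ Module.length R (R ⧸ Ideal.span {x}) := by
  refine le_trans ?_ (hK.length_linearMap_le (hK.isSMulRegular hx)
    (isFiniteLength_quotient_span_singleton R hx))
  let f : QuotSMulTop x K →ₗ[R] (R ⧸ Ideal.span {x}) →ₗ[R] QuotSMulTop x K :=
    { toFun e := Submodule.liftQ _ (LinearMap.toSpanSingleton R _ e) (by
        rw [Ideal.span, Submodule.span_le, Set.singleton_subset_iff]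
        exact Module.mem_annihilator.1 (QuotSMulTop.mem_annihilator (M := K) x) e)
      map_add' u v := Submodule.linearMap_qext _ (LinearMap.ext_ring (by
        change (1 : R) • (u + v) = (1 : R) • u + (1 : R) • v
        rw [smul_add]))
      map_smul' c u := Submodule.linearMap_qext _ (LinearMap.ext_ring (by
        change (1 : R) • c • u = c • (1 : R) • u
        rw [smul_comm])) }
  refine Module.length_le_of_injective f fun u v h => ?_
  have := LinearMap.congr_fun h (Submodule.Quotient.mk 1)
  change (1 : R) • u = (1 : R) • v at this
  simpa using this

end CanonicalModule

theorem LinearMap.surjective_of_injective_of_length_le {R M N : Type*} [CommRing R]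
    [AddCommGroup M] [Module R M] [AddCommGroup N] [Module R N] {f : M →ₗ[R] N}
    (hf : Function.Injective f) (hM : Module.length R M ≠ ⊤)
    (h : Module.length R N ≤ Module.length R M) : Function.Surjective f := by
  have e := Module.length_eq_add_of_exact f (LinearMap.range f).mkQ hf
    (Submodule.mkQ_surjective _) (LinearMap.exact_map_mkQ_range f)
  have h0 : Module.length R (N ⧸ LinearMap.range f) = 0 := by
    have h1 : Module.length R M + Module.length R (N ⧸ LinearMap.range f) ≤
        Module.length R M + 0 := by rw [← e, add_zero]; exact h
    exact nonpos_iff_eq_zero.1 ((ENat.add_le_add_iff_left hM).1 h1)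
  rw [Module.length_eq_zero_iff, Submodule.Quotient.subsingleton_iff] at h0
  exact LinearMap.range_eq_top.1 h0

theorem length_quotSMulTop_eq {R A V : Type*} [CommRing R] [AddCommGroup A] [Module R A]
    [AddCommGroup V] [Module R V] {a : R} (ha : IsSMulRegular V a) {j : A →ₗ[R] V}
    (hj : Function.Injective j) (hV : Module.length R (V ⧸ LinearMap.range j) ≠ ⊤) :
    Module.length R (QuotSMulTop a A) = Module.length R (QuotSMulTop a V) := by
  let L := LinearMap.range j
  let aL : Submodule R V := L.map (LinearMap.lsmul R V a)
  have hmem (v : V) : v ∈ aL ↔ ∃ u : A, a • j u = v := by simp [aL, L]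
  have hL : aL ≤ L := by
    intro v hv
    obtain ⟨u, rfl⟩ := (hmem v).1 hv
    exact ⟨a • u, map_smul _ _ _⟩
  have haV : aL ≤ a • (⊤ : Submodule R V) := by
    intro v hv
    obtain ⟨u, rfl⟩ := (hmem v).1 hv
    exact (Submodule.mem_smul_pointwise_iff_exists _ _ _).2 ⟨j u, trivial, rfl⟩
  have e1 : Module.length R (V ⧸ aL) =
      Module.length R (QuotSMulTop a A) + Module.length R (V ⧸ L) := by
    let f : QuotSMulTop a A →ₗ[R] V ⧸ aL := Submodule.mapQ _ _ j (by
      intro v hv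
      obtain ⟨u, -, rfl⟩ := (Submodule.mem_smul_pointwise_iff_exists _ _ _).1 hv
      exact (hmem _).2 ⟨u, (map_smul _ _ _).symm⟩)
    refine Module.length_eq_add_of_exact f (Submodule.factor hL) ?_
      (Submodule.factor_surjective hL) fun v => ?_
    · rw [injective_iff_map_eq_zero]
      intro u hu
      obtain ⟨u, rfl⟩ := Submodule.Quotient.mk_surjective _ u
      obtain ⟨w, hw⟩ := (hmem _).1 ((Submodule.Quotient.mk_eq_zero _).1 hu)
      exact QuotSMulTop.mk_eq_zero_iff.2 ⟨w, hj (by rw [map_smul, hw])⟩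
    · obtain ⟨v, rfl⟩ := Submodule.Quotient.mk_surjective _ v
      constructor
      · intro h
        obtain ⟨u, rfl⟩ := (Submodule.Quotient.mk_eq_zero L).1 h
        exact ⟨Submodule.Quotient.mk u, rfl⟩
      · rintro ⟨u, hu⟩
        obtain ⟨u, rfl⟩ := Submodule.Quotient.mk_surjective _ u
        rw [← hu]
        exact (Submodule.Quotient.mk_eq_zero L).2 ⟨u, rfl⟩
  have e2 : Module.length R (V ⧸ aL) =
      Module.length R (V ⧸ L) + Module.length R (QuotSMulTop a V) := by
    let f : V ⧸ L →ₗ[R] V ⧸ aL := Submodule.mapQ _ _ (LinearMap.lsmul R V a)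
      (Submodule.le_comap_map _ _)
    refine Module.length_eq_add_of_exact f (Submodule.factor haV) ?_
      (Submodule.factor_surjective haV) fun v => ?_
    · rw [injective_iff_map_eq_zero]
      intro u hu
      obtain ⟨u, rfl⟩ := Submodule.Quotient.mk_surjective _ u
      obtain ⟨w, hw⟩ := (hmem _).1 ((Submodule.Quotient.mk_eq_zero _).1 hu)
      exact (Submodule.Quotient.mk_eq_zero _).2 ⟨w, ha hw⟩
    · obtain ⟨v, rfl⟩ := Submodule.Quotient.mk_surjective _ v
      constructor
      · intro h
        obtain ⟨u, rfl⟩ := QuotSMulTop.mk_eq_zero_iff.1 h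
        exact ⟨Submodule.Quotient.mk u, rfl⟩
      · rintro ⟨u, hu⟩
        obtain ⟨u, rfl⟩ := Submodule.Quotient.mk_surjective _ u
        rw [← hu]
        exact QuotSMulTop.mk_eq_zero_iff.2 ⟨u, rfl⟩
  rw [e1] at e2
  rw [add_comm (Module.length R (V ⧸ L))] at e2
  exact ENat.add_left_injective_of_ne_top hV e2

theorem length_quotSMulTop_eq_of_forall_exists {R A V : Type*} [CommRing R] [AddCommGroup A]
    [Module R A] [AddCommGroup V] [Module R V] {a x : R} (ha : IsSMulRegular V a)
    {j : A →ₗ[R] V} (hj : Function.Injective j) (hx : ∀ v, ∃ u, j u = x • v)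
    (hV : Module.length R (QuotSMulTop x V) ≠ ⊤) :
    Module.length R (QuotSMulTop a A) = Module.length R (QuotSMulTop a V) := by
  have hle : x • (⊤ : Submodule R V) ≤ LinearMap.range j := by
    intro v hv
    obtain ⟨u, -, rfl⟩ := (Submodule.mem_smul_pointwise_iff_exists _ _ _).1 hv
    exact hx u
  exact length_quotSMulTop_eq ha hj (ne_top_of_le_ne_top hV
    (Module.length_le_of_surjective _ (Submodule.factor_surjective hle)))

theorem length_quotSMulTop_self {R : Type*} [CommRing R] (x : R) :
    Module.length R (QuotSMulTop x R) = Module.length R (R ⧸ Ideal.span {x}) := by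
  refine (Submodule.quotEquivOfEq _ _ ?_).length_eq
  ext v
  simp [Submodule.mem_smul_pointwise_iff_exists, Ideal.mem_span_singleton, Dvd.dvd, eq_comm]

/-- Every homomorphism `N → N / aN` lifts to an endomorphism of `N`. -/
def EndLiftsMod (S N : Type*) [CommRing S] [AddCommGroup N] [Module S N] (a : S) : Prop :=
  ∀ φ : N →ₗ[S] QuotSMulTop a N, ∃ g : N →ₗ[S] N, ∀ n, Submodule.Quotient.mk (g n) = φ n

section IdealLike

variable {S N : Type*} [CommRing S] [AddCommGroup N] [Module S N] {ι : N →ₗ[S] S}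
  (hι : Function.Injective ι) {X : N} {a : S} (ha : a ∈ nonZeroDivisors S)

include hι

theorem smul_comm_of_injective (m n : N) : ι m • n = ι n • m :=
  hι (by simp [mul_comm])

include ha in
theorem isSMulRegular_of_injective : IsSMulRegular N a :=
  .of_injective ι hι (isSMulRegular_iff_right_eq_zero_of_smul.2 fun _ hs =>
    (mul_left_mem_nonZeroDivisors_eq_zero_iff ha).1 hs)

include ha

theorem length_quotSMulTop_ideal (hX : Module.length S (S ⧸ Ideal.span {ι X}) ≠ ⊤) :
    Module.length S (QuotSMulTop a N) = Module.length S (S ⧸ Ideal.span {a}) := by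
  rw [← length_quotSMulTop_self] at hX ⊢
  exact length_quotSMulTop_eq_of_forall_exists
    (isSMulRegular_of_injective (ι := LinearMap.id) Function.injective_id ha) hι
    (fun v => ⟨v • X, by simp [mul_comm]⟩) hX

theorem length_quotSMulTop_end (hXn : ι X ∈ nonZeroDivisors S)
    (hX : Module.length S (S ⧸ Ideal.span {ι X}) ≠ ⊤) :
    Module.length S (QuotSMulTop a (N →ₗ[S] N)) = Module.length S (S ⧸ Ideal.span {a}) := by
  rw [← length_quotSMulTop_self] at hX ⊢
  refine length_quotSMulTop_eq_of_forall_exists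
    (isSMulRegular_of_injective (ι := LinearMap.id) Function.injective_id ha)
    (j := ι ∘ₗ LinearMap.applyₗ X) ?_
    (fun v => ⟨v • LinearMap.id, by simp [mul_comm]⟩) hX
  rw [injective_iff_map_eq_zero]
  intro b hb
  have hb' : b X = 0 := hι (by simpa using hb)
  ext n
  refine isSMulRegular_of_injective hι hXn ?_
  simp only [LinearMap.zero_apply, smul_zero]
  rw [← map_smul, smul_comm_of_injective hι, map_smul, hb', smul_zero]

omit hι ha in
theorem exists_injective_quotSMulTop_end (hN : IsSMulRegular N a) :
    ∃ f : QuotSMulTop a (N →ₗ[S] N) →ₗ[S] (N →ₗ[S] QuotSMulTop a N), Function.Injective f ∧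
      ∀ b n, f (Submodule.Quotient.mk b) n = Submodule.Quotient.mk (b n) := by
  let f : QuotSMulTop a (N →ₗ[S] N) →ₗ[S] (N →ₗ[S] QuotSMulTop a N) :=
    Submodule.liftQ _ (LinearMap.compRight S (Submodule.mkQ _)) (by
      intro b hb
      obtain ⟨c, -, rfl⟩ := (Submodule.mem_smul_pointwise_iff_exists _ _ _).1 hb
      refine LinearMap.ext fun n => QuotSMulTop.mk_eq_zero_iff.2 ⟨c n, rfl⟩)
  refine ⟨f, ?_, fun b n => rfl⟩
  rw [injective_iff_map_eq_zero]
  intro b hb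
  obtain ⟨b, rfl⟩ := Submodule.Quotient.mk_surjective _ b
  obtain ⟨g, hg⟩ := exists_smul_eq_of_forall_exists hN b
    (fun n => QuotSMulTop.mk_eq_zero_iff.1 (LinearMap.congr_fun hb n))
  exact QuotSMulTop.mk_eq_zero_iff.2 ⟨g, hg.symm⟩

theorem endLiftsMod_of_length_le (hXn : ι X ∈ nonZeroDivisors S)
    (hX : Module.length S (S ⧸ Ideal.span {ι X}) ≠ ⊤)
    (ha' : Module.length S (S ⧸ Ideal.span {a}) ≠ ⊤)
    (h : Module.length S (N →ₗ[S] QuotSMulTop a N) ≤ Module.length S (S ⧸ Ideal.span {a})) :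
    EndLiftsMod S N a := by
  obtain ⟨f, hf, hfb⟩ := exists_injective_quotSMulTop_end (isSMulRegular_of_injective hι ha)
  have hlen := length_quotSMulTop_end hι ha hXn hX
  have hsurj := LinearMap.surjective_of_injective_of_length_le hf (hlen ▸ ha') (hlen ▸ h)
  intro φ
  obtain ⟨b, rfl⟩ := hsurj φ
  obtain ⟨b, rfl⟩ := Submodule.Quotient.mk_surjective _ b
  exact ⟨b, fun n => (hfb b n).symm⟩

theorem length_linearMap_quotSMulTop_le (hXn : ι X ∈ nonZeroDivisors S)
    (hX : Module.length S (S ⧸ Ideal.span {ι X}) ≠ ⊤) (h : EndLiftsMod S N a) :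
    Module.length S (N →ₗ[S] QuotSMulTop a N) ≤ Module.length S (S ⧸ Ideal.span {a}) := by
  obtain ⟨f, hf, hfb⟩ := exists_injective_quotSMulTop_end (isSMulRegular_of_injective hι ha)
  rw [← length_quotSMulTop_end hι ha hXn hX]
  refine Module.length_le_of_surjective f fun φ => ?_
  obtain ⟨g, hg⟩ := h φ
  exact ⟨Submodule.Quotient.mk g, LinearMap.ext fun n => (hfb g n).trans (hg n)⟩

/-- The lifting property does not depend on the regular element. -/
theorem EndLiftsMod.of_injective (hXn : ι X ∈ nonZeroDivisors S) (h : EndLiftsMod S N (ι X)) :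
    EndLiftsMod S N a := by
  have haN := isSMulRegular_of_injective hι ha
  have hXN := isSMulRegular_of_injective hι hXn
  intro φ
  obtain ⟨w, hw⟩ := Submodule.Quotient.mk_surjective _ (φ X)
  have key (i : N) : ∃ p q : N, Submodule.Quotient.mk p = φ i ∧
      ι i • w - ι X • p = a • q := by
    obtain ⟨p, hp⟩ := Submodule.Quotient.mk_surjective _ (φ i)
    have : (Submodule.Quotient.mk (ι i • w - ι X • p) : QuotSMulTop a N) = 0 := by
      rw [Submodule.Quotient.mk_sub, Submodule.Quotient.mk_smul, Submodule.Quotient.mk_smul,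
        hw, hp, ← map_smul, ← map_smul, smul_comm_of_injective hι, sub_self]
    obtain ⟨q, hq⟩ := QuotSMulTop.mk_eq_zero_iff.1 this
    exact ⟨p, q, hp, hq.symm⟩
  choose p q hp hq using key
  have hη (i : N) (p' q' : N) (hp' : Submodule.Quotient.mk p' = φ i)
      (hq' : ι i • w - ι X • p' = a • q') :
      (Submodule.Quotient.mk q' : QuotSMulTop (ι X) N) = Submodule.Quotient.mk (q i) := by
    rw [← sub_eq_zero, ← Submodule.Quotient.mk_sub, QuotSMulTop.mk_eq_zero_iff]
    rw [← hp, ← sub_eq_zero, ← Submodule.Quotient.mk_sub, QuotSMulTop.mk_eq_zero_iff] at hp'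
    obtain ⟨t, ht⟩ := hp'
    refine ⟨-t, haN ?_⟩
    simp only
    rw [smul_sub, ← hq, ← hq', smul_comm, smul_neg, ht]
    module
  let η : N →ₗ[S] QuotSMulTop (ι X) N :=
    { toFun i := Submodule.Quotient.mk (q i)
      map_add' i j := by
        rw [← Submodule.Quotient.mk_add]
        refine (hη (i + j) (p i + p j) _ ?_ ?_).symm
        · rw [Submodule.Quotient.mk_add, hp, hp, map_add]
        · rw [smul_add a, ← hq, ← hq, map_add]
          module
      map_smul' c i := by
        rw [RingHom.id_apply, ← Submodule.Quotient.mk_smul]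
        refine (hη (c • i) (c • p i) _ ?_ ?_).symm
        · rw [Submodule.Quotient.mk_smul, hp, map_smul]
        · rw [smul_comm a, ← hq, map_smul, smul_eq_mul]
          module }
  obtain ⟨g, hg⟩ := h η
  obtain ⟨θ, hθ⟩ := exists_smul_eq_of_forall_exists hXN
    (LinearMap.toSpanSingleton S N w ∘ₗ ι - a • g) (fun i => by
      have := hg i
      rw [← sub_eq_zero, show η i = Submodule.Quotient.mk (q i) from rfl,
        ← Submodule.Quotient.mk_sub, QuotSMulTop.mk_eq_zero_iff] at this
      obtain ⟨t, ht⟩ := this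
      refine ⟨p i - a • t, ?_⟩
      rw [smul_sub, smul_comm, ht, smul_sub, ← hq]
      simp only [LinearMap.sub_apply, LinearMap.comp_apply, LinearMap.toSpanSingleton_apply,
        LinearMap.smul_apply]
      module)
  refine ⟨θ, fun i => ?_⟩
  have h1 := hg i
  rw [← sub_eq_zero, show η i = Submodule.Quotient.mk (q i) from rfl,
    ← Submodule.Quotient.mk_sub, QuotSMulTop.mk_eq_zero_iff] at h1
  obtain ⟨t, ht⟩ := h1
  have h2 := LinearMap.congr_fun hθ i
  simp only [LinearMap.sub_apply, LinearMap.comp_apply, LinearMap.toSpanSingleton_apply,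
    LinearMap.smul_apply] at h2
  rw [← hp, ← sub_eq_zero, ← Submodule.Quotient.mk_sub, QuotSMulTop.mk_eq_zero_iff]
  refine ⟨-t, hXN ?_⟩
  simp only
  rw [smul_comm, smul_neg, ht, smul_sub (ι X), ← h2, neg_sub, smul_sub, ← hq]
  module

end IdealLike

section CanonicalModule

variable {R : Type u} [CommRing R] [IsLocalRing R] [IsNoetherianRing R] [Ring.KrullDimLE 1 R]
  {K : Type u} [AddCommGroup K] [Module R K]

omit [IsLocalRing R] [IsNoetherianRing R] [Ring.KrullDimLE 1 R] in
theorem exists_smul_eq_tmul {I : Ideal R} (x : I) (τ : I ⊗[R] (I →ₗ[R] K)) :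
    ∃ g : I →ₗ[R] K, (x : R) • τ = x ⊗ₜ g ∧ ∀ k : I, g k = (k : R) • evalMap R I K τ := by
  induction τ with
  | zero => exact ⟨0, by simp⟩
  | add τ σ hτ hσ =>
    obtain ⟨g, hg, hg'⟩ := hτ
    obtain ⟨h, hh, hh'⟩ := hσ
    exact ⟨g + h, by rw [smul_add, hg, hh, TensorProduct.tmul_add], fun k => by
      rw [LinearMap.add_apply, hg', hh', map_add, smul_add]⟩
  | tmul i f =>
    refine ⟨(i : R) • f, ?_, fun k => ?_⟩
    · rw [← TensorProduct.smul_tmul, ← TensorProduct.smul_tmul']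
      exact congrArg (· ⊗ₜ[R] f) (Subtype.ext (by simp [mul_comm]))
    · change (i : R) • f k = (k : R) • f i
      rw [← map_smul, ← map_smul]
      congr 1
      ext
      simp [mul_comm]

theorem IsCanonicalModuleAt.endLiftsMod (hK : IsCanonicalModuleAt R (maximalIdeal R) K)
    {x : R} (hxm : x ∈ maximalIdeal R) (hx : x ∈ nonZeroDivisors R) {I : Ideal R} (hxI : x ∈ I)
    (htf : Submodule.torsion R (I ⊗[R] (I →ₗ[R] K)) = ⊥) : EndLiftsMod R I x := by
  have hxK := hK.isSMulRegular hx
  have hfin := isFiniteLength_quotient_span_singleton R hx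
  have hR := Module.length_ne_top_iff.2 hfin
  have := hK.1
  have hinj : Function.Injective (evalMap R I K) := by
    rw [injective_iff_map_eq_zero]
    intro τ hτ
    obtain ⟨g, hg, hg'⟩ := exists_smul_eq_tmul ⟨x, hxI⟩ τ
    have : g = 0 := by
      ext k
      simp [hg', hτ]
    rw [this, TensorProduct.tmul_zero] at hg
    have : τ ∈ Submodule.torsion R (I ⊗[R] (I →ₗ[R] K)) :=
      (Submodule.mem_torsion_iff τ).2 ⟨⟨x, hx⟩, hg⟩
    rwa [htf, Submodule.mem_bot] at this
  have hT : Module.length R (QuotSMulTop x (I ⊗[R] (I →ₗ[R] K))) =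
      Module.length R (QuotSMulTop x K) :=
    length_quotSMulTop_eq_of_forall_exists hxK hinj (fun v =>
      ⟨⟨x, hxI⟩ ⊗ₜ (LinearMap.toSpanSingleton R K v ∘ₗ I.subtype), rfl⟩)
      (Module.length_ne_top_iff.2 (isFiniteLength_quotSMulTop K hfin))
  have hTfin : IsFiniteLength R (QuotSMulTop x (I ⊗[R] (I →ₗ[R] K))) := by
    rw [← Module.length_ne_top_iff, hT, Module.length_ne_top_iff]
    exact isFiniteLength_quotSMulTop K hfin
  have hann (e : QuotSMulTop x K) : x • e = 0 :=
    Module.mem_annihilator.1 (QuotSMulTop.mem_annihilator (M := K) x) e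
  let Φ : (I →ₗ[R] QuotSMulTop x I) →ₗ[R]
      (QuotSMulTop x (I ⊗[R] (I →ₗ[R] K)) →ₗ[R] QuotSMulTop x K) :=
    { toFun ψ := Submodule.liftQ _ (TensorProduct.lift
          ((QuotSMulTop.map (M := I) (M' := K) x).flip ∘ₗ ψ)) (by
        intro τ hτ
        obtain ⟨σ, -, rfl⟩ := (Submodule.mem_smul_pointwise_iff_exists _ _ _).1 hτ
        rw [LinearMap.mem_ker, map_smul, hann])
      map_add' ψ ψ' := Submodule.linearMap_qext _ (TensorProduct.ext' fun i f => by
        exact map_add (QuotSMulTop.map (M := I) (M' := K) x f) _ _)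
      map_smul' c ψ := Submodule.linearMap_qext _ (TensorProduct.ext' fun i f => by
        exact map_smul (QuotSMulTop.map (M := I) (M' := K) x f) _ _) }
  have hΦ : Function.Injective Φ := by
    rw [injective_iff_map_eq_zero]
    intro ψ hψ
    ext i
    obtain ⟨j, hj⟩ := Submodule.Quotient.mk_surjective _ (ψ i)
    rw [← hj]
    by_contra hne
    obtain ⟨f, hf⟩ := hK.exists_apply_ne_zero hxm hx hxI hne
    apply hf
    have := LinearMap.congr_fun hψ (Submodule.Quotient.mk (i ⊗ₜ f))
    change QuotSMulTop.map x f (ψ i) = 0 at this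
    rwa [← hj] at this
  have hlen : Module.length R (I →ₗ[R] QuotSMulTop x I) ≤ Module.length R (R ⧸ Ideal.span {x}) :=
    (Module.length_le_of_injective Φ hΦ).trans ((hK.length_linearMap_le hxK hTfin).trans
      (hT.le.trans (hK.length_quotSMulTop_le hx)))
  exact endLiftsMod_of_length_le (ι := I.subtype) (X := ⟨x, hxI⟩) (Submodule.injective_subtype I)
    hx hx hR hR hlen

end CanonicalModule

theorem LinearMap.injective_of_surjective_of_length_le {R M N : Type*} [CommRing R]
    [AddCommGroup M] [Module R M] [AddCommGroup N] [Module R N] {f : M →ₗ[R] N}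
    (hf : Function.Surjective f) (hN : Module.length R N ≠ ⊤)
    (h : Module.length R M ≤ Module.length R N) : Function.Injective f := by
  have e := Module.length_eq_add_of_exact (LinearMap.ker f).subtype f
    (Submodule.injective_subtype _) hf (LinearMap.exact_subtype_ker_map f)
  have h0 : Module.length R (LinearMap.ker f) = 0 := by
    have h1 : Module.length R (LinearMap.ker f) + Module.length R N ≤
        0 + Module.length R N := by rw [← e, zero_add]; exact h
    exact nonpos_iff_eq_zero.1 ((ENat.add_le_add_iff_right hN).1 h1)
  rw [Module.length_eq_zero_iff, Submodule.subsingleton_iff_eq_bot] at h0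
  exact LinearMap.ker_eq_bot.1 h0

section CoreLemma

variable {S M : Type*} [CommRing S] [IsLocalRing S] [AddCommGroup M] [Module S M]

theorem exists_dual_system [Module.Finite S M] :
    ∃ (r : ℕ) (π : Fin r → M →ₗ[S] S ⧸ maximalIdeal S) (x : Fin r → M),
      (∀ i j, π i (x j) = if i = j then 1 else 0) ∧ Submodule.span S (Set.range x) = ⊤ := by
  let _ := Ideal.Quotient.field (maximalIdeal S)
  let V := M ⧸ (maximalIdeal S • ⊤ : Submodule S M)
  have : Module.Finite (S ⧸ maximalIdeal S) V := Module.Finite.of_restrictScalars_finite S _ _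
  let b := Module.finBasis (S ⧸ maximalIdeal S) V
  choose x hx using fun i => Submodule.Quotient.mk_surjective (maximalIdeal S • ⊤ : Submodule S M)
    (b i)
  refine ⟨_, fun i => (b.coord i).restrictScalars S ∘ₗ Submodule.mkQ _, x, fun i j => ?_, ?_⟩
  · change b.coord i (Submodule.Quotient.mk (x j)) = _
    rw [hx]
    simp [Finsupp.single_apply, eq_comm]
  · rw [← top_le_iff]
    refine Submodule.le_of_le_smul_of_le_jacobson_bot (I := maximalIdeal S) Module.Finite.fg_top
      (maximalIdeal_le_jacobson _) ?_
    intro v _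
    have hv := b.sum_repr (Submodule.Quotient.mk v)
    choose c hc using fun i => Ideal.Quotient.mk_surjective (b.repr (Submodule.Quotient.mk v) i)
    have h0 : (Submodule.Quotient.mk (v - ∑ i, c i • x i) : V) = 0 := by
      rw [Submodule.Quotient.mk_sub, sub_eq_zero, ← hv]
      change _ = Submodule.mkQ (maximalIdeal S • ⊤ : Submodule S M) (∑ i, c i • x i)
      rw [map_sum]
      refine Finset.sum_congr rfl fun i _ => ?_
      rw [map_smul, Submodule.mkQ_apply, hx, ← hc]
      rfl
    rw [Submodule.Quotient.mk_eq_zero] at h0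
    rw [← sub_add_cancel v (∑ i, c i • x i), add_comm]
    exact Submodule.add_mem_sup (Submodule.sum_mem _ fun i _ => Submodule.smul_mem _ _
      (Submodule.subset_span ⟨i, rfl⟩)) h0

/-- The homomorphisms `M → M` that factor through `M / mM` and the socle of `M`. -/
def socleEnd {r : ℕ} (π : Fin r → M →ₗ[S] S ⧸ maximalIdeal S) :
    (Fin r → Submodule.torsionBySet S M (maximalIdeal S)) →ₗ[S] M →ₗ[S] M where
  toFun w := (Submodule.torsionBySet S M (maximalIdeal S)).subtype ∘ₗ
    ∑ i, ((LinearMap.toSpanSingleton (S ⧸ maximalIdeal S) _ (w i)).restrictScalars S) ∘ₗ π i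
  map_add' w w' := by
    ext v
    simp [Finset.sum_add_distrib]
  map_smul' c w := by
    ext v
    simp only [LinearMap.comp_apply, LinearMap.sum_apply, map_sum, LinearMap.smul_apply,
      Finset.smul_sum, RingHom.id_apply]
    refine Finset.sum_congr rfl fun i _ => ?_
    rw [← map_smul]
    congr 1
    obtain ⟨d, hd⟩ := Ideal.Quotient.mk_surjective (π i v)
    change π i v • c • w i = c • π i v • w i
    rw [← hd]
    exact smul_comm d c (w i)

theorem length_torsionBySet_le_one_or
    (h : Module.length S (Submodule.torsionBySet S M (maximalIdeal S)) ≤ 1) (u v : M)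
    (hu : ∀ y ∈ maximalIdeal S, y • u = 0) (hv : ∀ y ∈ maximalIdeal S, y • v = 0) :
    ∃ c : S, u = c • v ∨ v = c • u := by
  by_cases hv0 : v = 0
  · exact ⟨0, Or.inr (by simp [hv0])⟩
  let u' : Submodule.torsionBySet S M (maximalIdeal S) :=
    ⟨u, (Submodule.mem_torsionBySet_iff _ _).2 fun y => hu y y.2⟩
  let v' : Submodule.torsionBySet S M (maximalIdeal S) :=
    ⟨v, (Submodule.mem_torsionBySet_iff _ _).2 fun y => hv y y.2⟩
  have hv' : v' ≠ 0 := fun h => hv0 (congrArg Subtype.val h)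
  have : Nontrivial (Submodule.torsionBySet S M (maximalIdeal S)) := ⟨⟨_, _, hv'⟩⟩
  have := Module.length_eq_one_iff.1 (le_antisymm h
    (Order.one_le_iff_pos.2 (Module.length_pos (R := S))))
  obtain ⟨c, hc⟩ := IsSimpleModule.toSpanSingleton_surjective S hv' u'
  exact ⟨c, Or.inl (congrArg Subtype.val hc).symm⟩

/-- A module of length at most `6` whose endomorphism module is not longer than itself is cyclic
or has simple socle. -/
theorem exists_span_eq_top_or_of_length_le_six (hM : Module.length S M ≤ 6)
    (hE : Module.length S (M →ₗ[S] M) ≤ Module.length S M) :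
    (∃ y : M, Submodule.span S {y} = ⊤) ∨
      ∀ u v : M, (∀ y ∈ maximalIdeal S, y • u = 0) → (∀ y ∈ maximalIdeal S, y • v = 0) →
        ∃ c : S, u = c • v ∨ v = c • u := by
  have hMtop : Module.length S M ≠ ⊤ := ne_top_of_le_ne_top (by decide) hM
  have := (isFiniteLength_iff_isNoetherian_isArtinian.1 (Module.length_ne_top_iff.1 hMtop)).1
  obtain ⟨r, π, x, hπ, hx⟩ := exists_dual_system (S := S) (M := M)
  by_cases hr : r ≤ 1
  · left
    rcases Nat.le_one_iff_eq_zero_or_eq_one.1 hr with rfl | rfl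
    · refine ⟨0, ?_⟩
      simpa using hx
    · refine ⟨x 0, ?_⟩
      rwa [Set.range_unique] at hx
  let Soc := Submodule.torsionBySet S M (maximalIdeal S)
  have hSoc (v : M) : v ∈ Soc ↔ ∀ y ∈ maximalIdeal S, y • v = 0 := by
    simp [Soc, Submodule.mem_torsionBySet_iff]
  by_cases hs : Module.length S Soc ≤ 1
  · exact Or.inr (length_torsionBySet_le_one_or hs)
  exfalso
  let Φ := socleEnd π
  have hΦSoc (w v) : Φ w v ∈ Soc := Submodule.coe_mem _
  have hΦx (w i) : Φ w (x i) = w i := by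
    simp [Φ, socleEnd, hπ]
  have hΦinj : Function.Injective Φ := fun w w' h => funext fun i => Subtype.ext (by
    rw [← hΦx, ← hΦx, h])
  let J := LinearMap.range Φ
  let θ : S →ₗ[S] (M →ₗ[S] M) ⧸ J := J.mkQ ∘ₗ LinearMap.toSpanSingleton S _ LinearMap.id
  let a := LinearMap.ker θ
  have ha (c : S) : c ∈ a ↔ ∃ w, Φ w = c • LinearMap.id := by
    rw [LinearMap.mem_ker]
    exact Submodule.Quotient.mk_eq_zero J
  have haSoc (c : S) (hc : c ∈ a) (v : M) : c • v ∈ Soc := by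
    obtain ⟨w, hw⟩ := (ha c).1 hc
    have := hΦSoc w v
    rwa [hw] at this
  have eE : Module.length S (M →ₗ[S] M) =
      Module.length S (Fin r → Soc) + Module.length S ((M →ₗ[S] M) ⧸ J) :=
    Module.length_eq_add_of_exact Φ J.mkQ hΦinj (Submodule.mkQ_surjective _)
      (LinearMap.exact_map_mkQ_range Φ)
  rw [Module.length_pi, ENat.card_eq_coe_fintype_card, Fintype.card_fin] at eE
  have hθ : Function.Injective (a.liftQ θ le_rfl) := LinearMap.ker_eq_bot.1
    (Submodule.ker_liftQ_eq_bot _ _ _ le_rfl)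
  have hq := Module.length_le_of_injective _ hθ
  have eM : Module.length S M = Module.length S Soc + Module.length S (M ⧸ Soc) :=
    Module.length_eq_add_of_exact Soc.subtype Soc.mkQ (Submodule.injective_subtype _)
      (Submodule.mkQ_surjective _) (LinearMap.exact_subtype_mkQ Soc)
  let ρ (i : Fin r) : (S ⧸ a) →ₗ[S] M ⧸ Soc :=
    a.liftQ (LinearMap.toSpanSingleton S _ (Soc.mkQ (x i))) fun c hc =>
      (Submodule.Quotient.mk_eq_zero Soc).2 (haSoc c hc (x i))
  let ψ : (Fin r → S ⧸ a) →ₗ[S] M ⧸ Soc := LinearMap.lsum S _ S ρ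
  have hψ (c : Fin r → S) : ψ (fun i => Submodule.Quotient.mk (c i)) =
      Soc.mkQ (∑ i, c i • x i) := by
    rw [map_sum]
    simp only [ψ, LinearMap.lsum_apply, LinearMap.sum_apply, LinearMap.comp_apply, map_smul]
    rfl
  have hψsurj : Function.Surjective ψ := by
    intro v
    obtain ⟨v, rfl⟩ := Submodule.Quotient.mk_surjective _ v
    obtain ⟨c, rfl⟩ := (Submodule.mem_span_range_iff_exists_fun S).1
      (hx ▸ Submodule.mem_top : v ∈ Submodule.span S (Set.range x))
    exact ⟨_, hψ c⟩
  have hle := Module.length_le_of_surjective ψ hψsurj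
  have eq := Module.length_pi (R := S) (M := S ⧸ a) (ι := Fin r)
  rw [ENat.card_eq_coe_fintype_card, Fintype.card_fin] at eq
  have fM : Module.length S (M ⧸ Soc) ≠ ⊤ := by
    intro h
    rw [h, add_top] at eM
    exact hMtop eM
  have fS : Module.length S Soc ≠ ⊤ := by
    intro h
    rw [h, top_add] at eM
    exact hMtop eM
  have fE : Module.length S (M →ₗ[S] M) ≠ ⊤ := ne_top_of_le_ne_top hMtop hE
  have fJ : Module.length S ((M →ₗ[S] M) ⧸ J) ≠ ⊤ := by
    intro h
    rw [h, add_top] at eE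
    exact fE eE
  have fq : Module.length S (S ⧸ a) ≠ ⊤ := ne_top_of_le_ne_top fJ hq
  obtain ⟨e, he⟩ := ENat.ne_top_iff_exists.1 hMtop
  obtain ⟨s, hs'⟩ := ENat.ne_top_iff_exists.1 fS
  obtain ⟨t, ht⟩ := ENat.ne_top_iff_exists.1 fM
  obtain ⟨E, hE'⟩ := ENat.ne_top_iff_exists.1 fE
  obtain ⟨p, hp⟩ := ENat.ne_top_iff_exists.1 fJ
  obtain ⟨q, hq'⟩ := ENat.ne_top_iff_exists.1 fq
  rw [eq] at hle
  rw [← he, ← hs', ← ht] at eM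
  rw [← hE', ← hs', ← hp] at eE
  rw [← ht, ← hq'] at hle
  rw [← hp, ← hq'] at hq
  rw [← he, ← hE'] at hE
  rw [← he] at hM
  rw [← hs'] at hs
  norm_cast at eM eE hle hq hE hM hs
  have key : ∀ r : ℕ, 2 ≤ r → E = r * s + p → t ≤ r * q →
      r = 2 ∧ s = 2 ∧ q = 2 ∧ p = 2 ∧ t = 4 := by
    clear! r
    intro r hr eE hle
    have h1 : r * s ≤ 6 := by omega
    have h2 : r ≤ 3 := by nlinarith
    have h3 : s ≤ 3 := by nlinarith
    interval_cases r <;> interval_cases s <;> omega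
  obtain ⟨rfl, rfl, rfl, rfl, rfl⟩ := key r (by omega) eE hle
  have hθsurj : Function.Surjective (a.liftQ θ le_rfl) :=
    LinearMap.surjective_of_injective_of_length_le hθ fq (by rw [← hp, ← hq'])
  have hψinj : Function.Injective ψ :=
    LinearMap.injective_of_surjective_of_length_le hψsurj fM (by
      rw [eq, ← hq', ← ht]
      norm_cast)
  have hmem (c : Fin 2 → S) (h : ∑ i, c i • x i ∈ Soc) (i : Fin 2) : c i ∈ a := by
    have h0 : ψ (fun i => Submodule.Quotient.mk (c i)) = 0 := by
      rw [hψ]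
      exact (Submodule.Quotient.mk_eq_zero Soc).2 h
    exact (Submodule.Quotient.mk_eq_zero a).1 (congrFun (hψinj (h0.trans (map_zero ψ).symm)) i)
  obtain ⟨t, htm, hta⟩ : ∃ t ∈ maximalIdeal S, t ∉ a := by
    by_contra! h
    have : Module.length S (S ⧸ a) ≤ 1 := by
      refine Module.length_le_one_of_forall_exists_smul_eq (fun y hy u => ?_) fun u v => ?_
      · obtain ⟨u, rfl⟩ := Submodule.Quotient.mk_surjective _ u
        rw [← Submodule.Quotient.mk_smul, Submodule.Quotient.mk_eq_zero]
        rw [smul_eq_mul, mul_comm]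
        exact a.smul_mem u (h y hy)
      · obtain ⟨u, rfl⟩ := Submodule.Quotient.mk_surjective _ u
        obtain ⟨v, rfl⟩ := Submodule.Quotient.mk_surjective _ v
        by_cases hu : u ∈ maximalIdeal S
        · refine ⟨0, Or.inl ?_⟩
          rw [zero_smul, Submodule.Quotient.mk_eq_zero]
          exact h u hu
        · obtain ⟨u, rfl⟩ : IsUnit u := by simpa using hu
          refine ⟨v * (↑u⁻¹ : S), Or.inr ?_⟩
          rw [← Submodule.Quotient.mk_smul, smul_eq_mul, mul_assoc, Units.inv_mul, mul_one]
    rw [← hq'] at this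
    exact absurd this (by decide)
  let Ψ := LinearEquiv.ofBijective ψ ⟨hψinj, hψsurj⟩
  let τ : (S ⧸ a) →ₗ[S] M := a.liftQ (LinearMap.toSpanSingleton S M (t • x 1)) fun c hc => by
    change c • t • x 1 = 0
    rw [smul_comm]
    exact (hSoc _).1 (haSoc c hc _) t htm
  let φ : M →ₗ[S] M := τ ∘ₗ LinearMap.proj 0 ∘ₗ Ψ.symm.toLinearMap ∘ₗ Soc.mkQ
  have hφ (c : Fin 2 → S) : φ (∑ i, c i • x i) = c 0 • t • x 1 := by
    change τ (Ψ.symm (Soc.mkQ _) 0) = _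
    rw [← hψ]
    change τ (Ψ.symm (Ψ _) 0) = _
    rw [LinearEquiv.symm_apply_apply]
    rfl
  have hφ0 : φ (x 0) = t • x 1 := by simpa using hφ ![1, 0]
  have hφ1 : φ (x 1) = 0 := by simpa using hφ ![0, 1]
  obtain ⟨c, hc⟩ := hθsurj (J.mkQ φ)
  obtain ⟨c, rfl⟩ := Submodule.Quotient.mk_surjective _ c
  change J.mkQ (c • LinearMap.id) = J.mkQ φ at hc
  rw [← sub_eq_zero, ← map_sub] at hc
  obtain ⟨w, hw⟩ := (Submodule.Quotient.mk_eq_zero J).1 hc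
  have hca : c ∈ a := by
    refine hmem ![0, c] ?_ 1
    have := hΦSoc w (x 1)
    rw [hw] at this
    simpa [hφ1] using this
  refine hta (hmem ![0, t] ?_ 1)
  have := sub_mem (haSoc c hca (x 0)) (hΦSoc w (x 0))
  rw [hw] at this
  simpa [hφ0] using this

end CoreLemma

section CanonicalModule

variable {R : Type u} [CommRing R] [IsLocalRing R] [IsNoetherianRing R] [Ring.KrullDimLE 1 R]
  {K : Type u} [AddCommGroup K] [Module R K]

theorem eq_bot_of_forall_exists_smul_eq {R M : Type*} [CommRing R] [IsLocalRing R]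
    [AddCommGroup M] [Module R M] {N : Submodule R M} (hN : N.FG) {x : R}
    (hx : x ∈ maximalIdeal R) (h : ∀ n ∈ N, ∃ u ∈ N, x • u = n) : N = ⊥ := by
  refine Submodule.eq_bot_of_le_smul_of_le_jacobson_bot (maximalIdeal R) N hN (fun n hn => ?_)
    (maximalIdeal_le_jacobson _)
  obtain ⟨u, hu, rfl⟩ := h n hn
  exact Submodule.smul_mem_smul hx hu

/-- If `I / xI` has simple socle, then `I` is isomorphic to the canonical module. -/
theorem IsCanonicalModuleAt.nonempty_linearEquiv
    (hK : IsCanonicalModuleAt R (maximalIdeal R) K) {x : R} (hxm : x ∈ maximalIdeal R)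
    (hx : x ∈ nonZeroDivisors R) {I : Ideal R} (hxI : x ∈ I)
    (hsoc : ∀ u v : QuotSMulTop x I, (∀ y ∈ maximalIdeal R, y • u = 0) →
      (∀ y ∈ maximalIdeal R, y • v = 0) → ∃ c : R, u = c • v ∨ v = c • u) :
    Nonempty (I ≃ₗ[R] K) := by
  have := hK.1
  have hxK := hK.isSMulRegular hx
  have hfin := isFiniteLength_quotient_span_singleton R hx
  have hMfin := isFiniteLength_quotSMulTop I hfin
  have := (isFiniteLength_iff_isNoetherian_isArtinian.1 hMfin).2
  have : Nontrivial (QuotSMulTop x I) := by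
    refine Submodule.Quotient.nontrivial_iff.2 fun h => ?_
    have h0 : (⊤ : Submodule R I) = ⊥ := by
      refine eq_bot_of_forall_exists_smul_eq Module.Finite.fg_top hxm fun n hn => ?_
      rw [← h] at hn
      obtain ⟨q, -, hq⟩ := (Submodule.mem_smul_pointwise_iff_exists _ _ _).1 hn
      exact ⟨q, trivial, hq⟩
    have h1 : (⟨x, hxI⟩ : I) ∈ (⊥ : Submodule R I) := h0 ▸ Submodule.mem_top
    exact nonZeroDivisors.ne_zero hx (congrArg Subtype.val ((Submodule.mem_bot R).1 h1))
  obtain ⟨v, hv0, hv⟩ := exists_ne_zero_forall_smul_eq_zero (R := R) (M := QuotSMulTop x I)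
  obtain ⟨v, rfl⟩ := Submodule.Quotient.mk_surjective _ v
  obtain ⟨w, hw0, hw⟩ := hK.exists_socle_quotSMulTop hxm hx
  obtain ⟨f, hf⟩ := hK.exists_apply_eq_of_ne_zero hxm hx hxI hv0 hw
  let F := QuotSMulTop.map x f
  have hFv : F (Submodule.Quotient.mk v) = w := hf
  have hFinj : Function.Injective F := by
    rw [← LinearMap.ker_eq_bot]
    by_contra hne
    have : Nontrivial (LinearMap.ker F) := Submodule.nontrivial_iff_ne_bot.2 hne
    obtain ⟨u, hu0, hu⟩ := exists_ne_zero_forall_smul_eq_zero (R := R) (M := LinearMap.ker F)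
    obtain ⟨c, hc | hc⟩ := hsoc u (Submodule.Quotient.mk v)
      (fun y hy => congrArg Subtype.val (hu y hy)) hv
    · by_cases hcm : c ∈ maximalIdeal R
      · exact hu0 (Subtype.ext (hc.trans (hv c hcm)))
      · obtain ⟨c, rfl⟩ : IsUnit c := by simpa using hcm
        have h1 : F u = 0 := u.2
        rw [hc, map_smul, hFv] at h1
        apply hw0
        rw [← one_smul R w, ← Units.inv_mul c, mul_smul, h1, smul_zero]
    · rw [hc, map_smul, show F u = 0 from u.2, smul_zero] at hFv
      exact hw0 hFv.symm
  have hlen : Module.length R (QuotSMulTop x I) = Module.length R (R ⧸ Ideal.span {x}) :=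
    length_quotSMulTop_ideal (ι := I.subtype) (X := ⟨x, hxI⟩) (Submodule.injective_subtype I) hx
      (Module.length_ne_top_iff.2 hfin)
  have hFsurj := LinearMap.surjective_of_injective_of_length_le hFinj
    (Module.length_ne_top_iff.2 hMfin) (by
      rw [hlen]
      exact hK.length_quotSMulTop_le hx)
  refine ⟨LinearEquiv.ofBijective f ⟨?_, ?_⟩⟩
  · rw [← LinearMap.ker_eq_bot]
    refine eq_bot_of_forall_exists_smul_eq (IsNoetherian.noetherian _) hxm fun n hn => ?_
    have h0 : F (Submodule.Quotient.mk n) = 0 := by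
      rw [LinearMap.mem_ker] at hn
      change Submodule.Quotient.mk (f n) = _
      rw [hn]
      rfl
    obtain ⟨n', rfl⟩ := QuotSMulTop.mk_eq_zero_iff.1 (hFinj (h0.trans (map_zero F).symm))
    refine ⟨n', hxK ?_, rfl⟩
    rw [LinearMap.mem_ker, map_smul] at hn
    simpa using hn
  · rw [← LinearMap.range_eq_top, ← top_le_iff]
    refine Submodule.le_of_le_smul_of_le_jacobson_bot (I := maximalIdeal R) Module.Finite.fg_top
      (maximalIdeal_le_jacobson _) fun k _ => ?_
    obtain ⟨i, hi⟩ := hFsurj (Submodule.Quotient.mk k)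
    obtain ⟨i, rfl⟩ := Submodule.Quotient.mk_surjective _ i
    have hi' : (Submodule.Quotient.mk (f i) : QuotSMulTop x K) = Submodule.Quotient.mk k := hi
    rw [← sub_eq_zero, ← Submodule.Quotient.mk_sub, QuotSMulTop.mk_eq_zero_iff] at hi'
    obtain ⟨t, ht⟩ := hi'
    rw [show k = f i + x • (-t) by rw [smul_neg, ht]; abel]
    exact Submodule.add_mem_sup ⟨i, rfl⟩ (Submodule.smul_mem_smul hxm trivial)

end CanonicalModule

section BaseChange

variable {R A M : Type*} [CommRing R] [CommRing A] [Algebra R A] [AddCommGroup M] [Module R M]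

theorem eq_sum_basis_tmul {ι : Type*} [Fintype ι] [DecidableEq ι] (b : Module.Basis ι R A)
    (n : A ⊗[R] M) : n = ∑ i, b i ⊗ₜ[R] TensorProduct.equivFinsuppOfBasisLeft b n i := by
  conv_lhs => rw [← (TensorProduct.equivFinsuppOfBasisLeft b).symm_apply_apply n]
  rw [TensorProduct.equivFinsuppOfBasisLeft_symm_apply, Finsupp.sum_fintype _ _ (by simp)]

theorem EndLiftsMod.baseChange [Module.Free R A] [Module.Finite R A] {x : R}
    (h : EndLiftsMod R M x) : EndLiftsMod A (A ⊗[R] M) (algebraMap R A x) := by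
  classical
  intro φ
  let b := Module.Free.chooseBasis R A
  let c := TensorProduct.equivFinsuppOfBasisLeft (N := M) b
  have hc (w w' : A ⊗[R] M) (i) (hw : (Submodule.Quotient.mk w :
      QuotSMulTop (algebraMap R A x) (A ⊗[R] M)) = Submodule.Quotient.mk w') :
      (Submodule.Quotient.mk (c w i) : QuotSMulTop x M) = Submodule.Quotient.mk (c w' i) := by
    rw [← sub_eq_zero, ← Submodule.Quotient.mk_sub, QuotSMulTop.mk_eq_zero_iff] at hw ⊢
    obtain ⟨u, hu⟩ := hw
    refine ⟨c u i, ?_⟩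
    rw [algebraMap_smul] at hu
    rw [← Finsupp.sub_apply, ← map_sub, ← hu, map_smul, Finsupp.smul_apply]
  choose w hw using fun m : M => Submodule.Quotient.mk_surjective _ (φ (1 ⊗ₜ m))
  let φ' (i) : M →ₗ[R] QuotSMulTop x M :=
    { toFun := fun m => Submodule.Quotient.mk (c (w m) i)
      map_add' := fun m m' => by
        rw [hc (w (m + m')) (w m + w m') i, map_add, Finsupp.add_apply, Submodule.Quotient.mk_add]
        rw [hw, Submodule.Quotient.mk_add, hw, hw, TensorProduct.tmul_add, map_add]
      map_smul' := fun r m => by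
        rw [hc (w (r • m)) (algebraMap R A r • w m) i, algebraMap_smul, map_smul,
          Finsupp.smul_apply, Submodule.Quotient.mk_smul, RingHom.id_apply]
        rw [hw, Submodule.Quotient.mk_smul, hw, ← map_smul, algebraMap_smul,
          TensorProduct.tmul_smul] }
  choose g hg using fun i => h (φ' i)
  refine ⟨∑ i, b i • (g i).baseChange A, fun n => ?_⟩
  have key (m : M) : (Submodule.Quotient.mk (∑ i, b i ⊗ₜ[R] g i m) :
      QuotSMulTop (algebraMap R A x) (A ⊗[R] M)) = φ (1 ⊗ₜ m) := by
    rw [← hw, ← sub_eq_zero, ← Submodule.Quotient.mk_sub, QuotSMulTop.mk_eq_zero_iff]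
    have h1 (i) : ∃ u, x • u = g i m - c (w m) i := by
      rw [← QuotSMulTop.mk_eq_zero_iff, Submodule.Quotient.mk_sub, sub_eq_zero]
      exact hg i m
    choose u hu using h1
    refine ⟨∑ i, b i ⊗ₜ[R] u i, ?_⟩
    rw [algebraMap_smul]
    conv_rhs => rw [eq_sum_basis_tmul b (w m)]
    rw [← Finset.sum_sub_distrib, Finset.smul_sum]
    refine Finset.sum_congr rfl fun i _ => ?_
    rw [← TensorProduct.tmul_sub, ← TensorProduct.tmul_smul, hu]
  induction n with
  | zero => simp
  | add n n' hn hn' => rw [map_add, map_add, Submodule.Quotient.mk_add, hn, hn']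
  | tmul a m =>
    have h1 : a ⊗ₜ[R] m = a • (1 : A) ⊗ₜ[R] m := by simp [TensorProduct.smul_tmul']
    rw [h1, map_smul, map_smul, Submodule.Quotient.mk_smul, ← key]
    simp [LinearMap.sum_apply, TensorProduct.smul_tmul']

theorem algebraMap_mem_nonZeroDivisors_of_flat [Module.Flat R A] {x : R}
    (hx : x ∈ nonZeroDivisors R) : algebraMap R A x ∈ nonZeroDivisors A := by
  have hreg : IsSMulRegular A (algebraMap R A x) := IsSMulRegular.of_flat
    (isSMulRegular_of_injective (ι := LinearMap.id) Function.injective_id hx)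
  refine mem_nonZeroDivisors_iff_right.2 fun z hz => hreg ?_
  change algebraMap R A x * z = algebraMap R A x * 0
  rw [mul_comm, hz, mul_zero]

theorem isFiniteLength_quotient_span_algebraMap [Module.Finite R A] {x : R}
    (hx : IsFiniteLength R (R ⧸ Ideal.span {x})) :
    IsFiniteLength A (A ⧸ Ideal.span {algebraMap R A x}) := by
  have h := isFiniteLength_quotSMulTop A hx
  have h' : IsFiniteLength R (A ⧸ Ideal.span {algebraMap R A x}) := by
    refine h.of_surjective (f := Submodule.liftQ (x • (⊤ : Submodule R A))
      ((Submodule.mkQ (Ideal.span {algebraMap R A x})).restrictScalars R) ?_) ?_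
    · intro u hu
      obtain ⟨v, -, rfl⟩ := (Submodule.mem_smul_pointwise_iff_exists _ _ _).1 hu
      rw [LinearMap.mem_ker, LinearMap.restrictScalars_apply, Submodule.mkQ_apply,
        Submodule.Quotient.mk_eq_zero, Algebra.smul_def]
      exact Ideal.mul_mem_right _ _ (Ideal.mem_span_singleton_self _)
    · intro u
      obtain ⟨v, rfl⟩ := Submodule.Quotient.mk_surjective _ u
      exact ⟨Submodule.Quotient.mk v, rfl⟩
  rw [isFiniteLength_iff_isNoetherian_isArtinian] at h' ⊢
  obtain ⟨_, _⟩ := h'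
  exact ⟨isNoetherian_of_tower R inferInstance, isArtinian_of_tower R inferInstance⟩

variable [IsLocalRing R] [IsLocalRing A]

theorem exists_span_singleton_eq_top_of_baseChange [Module.Free R A] [Module.Finite R M]
    {n : A ⊗[R] M} (hn : Submodule.span A {n} = ⊤) :
    ∃ y : M, Submodule.span R {y} = ⊤ := by
  obtain ⟨r, π, x, hπ, hx⟩ := exists_dual_system (S := R) (M := M)
  by_cases hr : r ≤ 1
  · rcases Nat.le_one_iff_eq_zero_or_eq_one.1 hr with rfl | rfl
    · exact ⟨0, by simpa using hx⟩
    · exact ⟨x 0, by rwa [Set.range_unique] at hx⟩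
  exfalso
  obtain ⟨r, rfl⟩ := Nat.exists_eq_add_of_le' (not_le.1 hr)
  have hs (m : A ⊗[R] M) : ∃ α : A, α • n = m := by
    rw [← Submodule.mem_span_singleton, hn]
    trivial
  obtain ⟨α, hα⟩ := hs (1 ⊗ₜ x 0)
  obtain ⟨β, hβ⟩ := hs (1 ⊗ₜ x 1)
  have h (i j) : (π i).baseChange A (1 ⊗ₜ x j) = if i = j then 1 else 0 := by
    rw [LinearMap.baseChange_tmul, hπ]
    split_ifs
    · rfl
    · simp
  have h00 := h 0 0
  have h10 := h 1 0
  have h11 := h 1 1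
  rw [← hα, map_smul] at h00 h10
  rw [← hβ, map_smul] at h11
  simp only [Fin.one_eq_zero_iff, if_true] at h00 h10 h11
  have hone : (1 : A ⊗[R] (R ⧸ maximalIdeal R)) = 0 := by
    rw [← h11]
    have h1 : (π 1).baseChange A n = 0 := by
      calc (π 1).baseChange A n = (α • (π 0).baseChange A n) * (π 1).baseChange A n := by
            rw [h00, one_mul]
        _ = (π 0).baseChange A n * (α • (π 1).baseChange A n) := by
            rw [smul_mul_assoc, mul_smul_comm]
        _ = 0 := by rw [h10]; simp
    rw [h1, smul_zero]
  have : Nontrivial (A ⊗[R] (R ⧸ maximalIdeal R)) := inferInstance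
  exact one_ne_zero hone

/-- Simplicity of the socle of `N / aN` descends to `M / xM`, where `N` is obtained from `M` by
extending scalars. -/
theorem exists_eq_smul_of_baseChange [Module.Free R A] [Module.Finite R A]
    (hmax : maximalIdeal A = (maximalIdeal R).map (algebraMap R A)) {a : A}
    (ham : a ∈ maximalIdeal A) {x : R} (haN : IsSMulRegular (A ⊗[R] M) a)
    (hxN : IsSMulRegular (A ⊗[R] M) (algebraMap R A x))
    (hsoc : ∀ u v : QuotSMulTop a (A ⊗[R] M), (∀ y ∈ maximalIdeal A, y • u = 0) →
      (∀ y ∈ maximalIdeal A, y • v = 0) → ∃ c : A, u = c • v ∨ v = c • u)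
    (u v : QuotSMulTop x M) (hu : ∀ y ∈ maximalIdeal R, y • u = 0)
    (hv : ∀ y ∈ maximalIdeal R, y • v = 0) : ∃ c : R, u = c • v ∨ v = c • u := by
  classical
  obtain ⟨u, rfl⟩ := Submodule.Quotient.mk_surjective _ u
  obtain ⟨v, rfl⟩ := Submodule.Quotient.mk_surjective _ v
  let X := algebraMap R A x
  have hmem (u : M) (hu : ∀ y ∈ maximalIdeal R,
      y • (Submodule.Quotient.mk u : QuotSMulTop x M) = 0) (t : A) (ht : t ∈ maximalIdeal A) :
      ∃ w : A ⊗[R] M, X • w = t • 1 ⊗ₜ u := by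
    let J : Ideal A := Submodule.comap (LinearMap.toSpanSingleton A (A ⊗[R] M) (1 ⊗ₜ u)) (X • ⊤)
    have hJ : (maximalIdeal R).map (algebraMap R A) ≤ J := by
      rw [Ideal.map_le_iff_le_comap]
      intro y hy
      have h1 := hu y hy
      rw [← Submodule.Quotient.mk_smul, QuotSMulTop.mk_eq_zero_iff] at h1
      obtain ⟨w, hw⟩ := h1
      change LinearMap.toSpanSingleton A (A ⊗[R] M) (1 ⊗ₜ u) (algebraMap R A y) ∈
        X • (⊤ : Submodule A (A ⊗[R] M))
      refine (Submodule.mem_smul_pointwise_iff_exists _ _ _).2 ⟨1 ⊗ₜ w, trivial, ?_⟩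
      rw [LinearMap.toSpanSingleton_apply, algebraMap_smul, algebraMap_smul,
        ← TensorProduct.tmul_smul, ← TensorProduct.tmul_smul, hw]
    have h2 : t ∈ J := hJ (hmax ▸ ht)
    obtain ⟨w, -, hw⟩ := (Submodule.mem_smul_pointwise_iff_exists _ _ _).1 h2
    exact ⟨w, hw⟩
  have hlift (u : M) (hu : ∀ y ∈ maximalIdeal R,
      y • (Submodule.Quotient.mk u : QuotSMulTop x M) = 0) : ∃ U : A ⊗[R] M,
      X • U = a • 1 ⊗ₜ u ∧ ∀ y ∈ maximalIdeal A,
        y • (Submodule.Quotient.mk U : QuotSMulTop a (A ⊗[R] M)) = 0 := by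
    obtain ⟨U, hU⟩ := hmem u hu a ham
    refine ⟨U, hU, fun y hy => ?_⟩
    obtain ⟨w, hw⟩ := hmem u hu y hy
    rw [← Submodule.Quotient.mk_smul, QuotSMulTop.mk_eq_zero_iff]
    refine ⟨w, hxN ?_⟩
    change X • a • w = X • y • U
    rw [smul_comm, hw, smul_comm X, hU, smul_comm]
  obtain ⟨U, hU, hUs⟩ := hlift u hu
  obtain ⟨V, hV, hVs⟩ := hlift v hv
  let b := Module.Free.chooseBasis R A
  have main (u v : M) (U V : A ⊗[R] M) (hU : X • U = a • 1 ⊗ₜ u) (hV : X • V = a • 1 ⊗ₜ v)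
      (c : A) (h : (Submodule.Quotient.mk U : QuotSMulTop a (A ⊗[R] M)) =
        c • Submodule.Quotient.mk V) :
      ∃ c : R, (Submodule.Quotient.mk u : QuotSMulTop x M) = c • Submodule.Quotient.mk v := by
    rw [← Submodule.Quotient.mk_smul, ← sub_eq_zero, ← Submodule.Quotient.mk_sub,
      QuotSMulTop.mk_eq_zero_iff] at h
    obtain ⟨w, hw⟩ := h
    have h1 : X • w = 1 ⊗ₜ u - c • 1 ⊗ₜ v := by
      apply haN
      change a • X • w = a • _
      rw [smul_comm, hw, smul_sub, smul_sub, hU, smul_comm X, hV, smul_comm c]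
    have h2 (i) : x • TensorProduct.equivFinsuppOfBasisLeft b w i =
        b.repr 1 i • u - b.repr c i • v := by
      have := DFunLike.congr_fun (congrArg (TensorProduct.equivFinsuppOfBasisLeft b) h1) i
      rwa [algebraMap_smul, map_smul, map_sub, TensorProduct.smul_tmul', smul_eq_mul, mul_one,
        Finsupp.sub_apply, Finsupp.smul_apply,
        TensorProduct.equivFinsuppOfBasisLeft_apply_tmul_apply,
        TensorProduct.equivFinsuppOfBasisLeft_apply_tmul_apply] at this
    obtain ⟨i, hi⟩ : ∃ i, IsUnit (b.repr 1 i) := by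
      by_contra! hne
      have h3 : (1 : A) ∈ maximalIdeal A := by
        rw [hmax, ← b.sum_repr 1]
        refine Ideal.sum_mem _ fun i _ => ?_
        rw [Algebra.smul_def]
        exact Ideal.mul_mem_right _ _ (Ideal.mem_map_of_mem _ ((mem_maximalIdeal _).2 (hne i)))
      exact (Ideal.ne_top_iff_one _).1 (maximalIdeal.isMaximal A).ne_top h3
    obtain ⟨ε, hε⟩ := hi
    refine ⟨ε⁻¹ * b.repr c i, ?_⟩
    rw [← Submodule.Quotient.mk_smul, ← sub_eq_zero, ← Submodule.Quotient.mk_sub,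
      QuotSMulTop.mk_eq_zero_iff]
    refine ⟨(↑ε⁻¹ : R) • TensorProduct.equivFinsuppOfBasisLeft b w i, ?_⟩
    rw [smul_comm, h2, ← hε, smul_sub, smul_smul, Units.inv_mul, one_smul, smul_smul]
  obtain ⟨c, hc | hc⟩ := hsoc _ _ hUs hVs
  · obtain ⟨c, hc⟩ := main u v U V hU hV c hc
    exact ⟨c, Or.inl hc⟩
  · obtain ⟨c, hc⟩ := main v u V U hV hU c hc
    exact ⟨c, Or.inr hc⟩

end BaseChange

theorem EndLiftsMod.exists_span_eq_top_or {R A : Type*} [CommRing R] [IsLocalRing R]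
    [IsNoetherianRing R] [CommRing A] [IsLocalRing A] [Algebra R A] [Module.Free R A]
    [Module.Finite R A] (hmax : maximalIdeal A = (maximalIdeal R).map (algebraMap R A)) {a : A}
    (ham : a ∈ maximalIdeal A) (ha : a ∈ nonZeroDivisors A)
    (hlen : Module.length A (A ⧸ Ideal.span {a}) ≤ 6) {I : Ideal R} {x : R} (hxI : x ∈ I)
    (hx : x ∈ nonZeroDivisors R) (hxfin : IsFiniteLength R (R ⧸ Ideal.span {x}))
    (h : EndLiftsMod R I x) :
    (∃ y : I, Submodule.span R {y} = ⊤) ∨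
      ∀ u v : QuotSMulTop x I, (∀ y ∈ maximalIdeal R, y • u = 0) →
        (∀ y ∈ maximalIdeal R, y • v = 0) → ∃ c : R, u = c • v ∨ v = c • u := by
  let N := A ⊗[R] I
  let ι : N →ₗ[A] A := (AlgebraTensorModule.rid R A A).toLinearMap ∘ₗ I.subtype.baseChange A
  have hι : Function.Injective ι := (AlgebraTensorModule.rid R A A).injective.comp
    (Module.Flat.lTensor_preserves_injective_linearMap _ (Submodule.injective_subtype I))
  let X : N := 1 ⊗ₜ ⟨x, hxI⟩
  have hX : ι X = algebraMap R A x := by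
    change AlgebraTensorModule.rid R A A (1 ⊗ₜ[R] x) = _
    rw [AlgebraTensorModule.rid_tmul, Algebra.smul_def, mul_one]
  have hXn : algebraMap R A x ∈ nonZeroDivisors A := algebraMap_mem_nonZeroDivisors_of_flat hx
  have hXfin := isFiniteLength_quotient_span_algebraMap (A := A) hxfin
  rw [← Module.length_ne_top_iff] at hXfin
  have hN := h.baseChange (A := A)
  rw [← hX] at hXn hXfin hN
  have hNa := EndLiftsMod.of_injective hι ha hXn hN
  have hlenN : Module.length A (QuotSMulTop a N) = Module.length A (A ⧸ Ideal.span {a}) :=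
    length_quotSMulTop_ideal hι ha hXfin
  have hEnd : Module.length A (QuotSMulTop a N →ₗ[A] QuotSMulTop a N) ≤
      Module.length A (QuotSMulTop a N) := by
    rw [hlenN]
    refine le_trans (Module.length_le_of_injective
      (LinearMap.lcomp A (QuotSMulTop a N) (Submodule.mkQ (a • (⊤ : Submodule A N)))) ?_)
      (length_linearMap_quotSMulTop_le hι ha hXn hXfin hNa)
    intro f g hfg
    refine LinearMap.ext fun n => ?_
    obtain ⟨n, rfl⟩ := Submodule.Quotient.mk_surjective _ n
    exact LinearMap.congr_fun hfg n
  rcases exists_span_eq_top_or_of_length_le_six (hlenN ▸ hlen) hEnd with ⟨y, hy⟩ | hsoc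
  · left
    obtain ⟨n, rfl⟩ := Submodule.Quotient.mk_surjective _ y
    refine exists_span_singleton_eq_top_of_baseChange (A := A) (n := n) ?_
    rw [← top_le_iff]
    refine Submodule.le_of_le_smul_of_le_jacobson_bot (I := maximalIdeal A) Module.Finite.fg_top
      (maximalIdeal_le_jacobson _) fun k _ => ?_
    obtain ⟨s, hs⟩ := Submodule.mem_span_singleton.1 (hy ▸ Submodule.mem_top :
      (Submodule.Quotient.mk k : QuotSMulTop a N) ∈ Submodule.span A {Submodule.Quotient.mk n})
    rw [eq_comm, ← Submodule.Quotient.mk_smul, ← sub_eq_zero, ← Submodule.Quotient.mk_sub,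
      QuotSMulTop.mk_eq_zero_iff] at hs
    obtain ⟨t, ht⟩ := hs
    rw [show k = s • n + a • t by rw [ht]; abel]
    exact Submodule.add_mem_sup (Submodule.smul_mem _ _ (Submodule.mem_span_singleton_self _))
      (Submodule.smul_mem_smul ham trivial)
  · right
    exact exists_eq_smul_of_baseChange hmax ham (isSMulRegular_of_injective hι ha)
      (hX ▸ isSMulRegular_of_injective hι hXn) hsoc

section Superficial

open Polynomial

/-- In large degrees, the associated graded ring has no nonzero element annihilated by a power of
its irrelevant ideal. -/
theorem exists_forall_mem_pow_succ {R : Type*} [CommRing R] [IsNoetherianRing R] (m : Ideal R) :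
    ∃ n₀, ∀ n ≥ n₀, ∀ g ∈ m ^ n, (∀ y ∈ m, y * g ∈ m ^ (n + 2)) → g ∈ m ^ (n + 1) := by
  let V : ℕ →o Ideal (reesAlgebra m) :=
    { toFun := fun N =>
        { carrier := {f | ∀ r : reesAlgebra m, ∀ n ≥ N, (r * f : R[X]).coeff n ∈ m ^ (n + 1)}
          add_mem' := fun hf hg r n hn => by
            simp only [Subalgebra.coe_add, mul_add, coeff_add]
            exact Ideal.add_mem _ (hf r n hn) (hg r n hn)
          zero_mem' := fun r n _ => by simp
          smul_mem' := fun c f hf r n hn => by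
            have := hf (r * c) n hn
            rwa [Subalgebra.coe_mul, mul_assoc] at this }
      monotone' := fun N N' h f hf r n hn => hf r n (h.trans hn) }
  obtain ⟨n₀, hn₀⟩ := monotone_stabilizes_iff_noetherian.2
    (inferInstanceAs (IsNoetherianRing (reesAlgebra m))) V
  refine ⟨n₀, fun n hn g hg h => ?_⟩
  let f : reesAlgebra m := ⟨monomial n g, reesAlgebra.monomial_mem.2 hg⟩
  have hf : f ∈ V (n + 1) := by
    intro r k hk
    obtain ⟨j, rfl⟩ := Nat.exists_eq_add_of_le hk
    change ((r : R[X]) * monomial n g).coeff _ ∈ _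
    rw [show n + 1 + j = (j + 1) + n by ring, coeff_mul_monomial]
    have hr := (mem_reesAlgebra_iff m _).1 r.2 (j + 1)
    have hmg : m * Ideal.span {g} ≤ m ^ (n + 2) := by
      rw [Ideal.mul_le]
      intro y hy z hz
      obtain ⟨c, rfl⟩ := Ideal.mem_span_singleton'.1 hz
      rw [mul_left_comm]
      exact Ideal.mul_mem_left _ _ (h y hy)
    have h1 : m ^ (j + 1) * Ideal.span {g} ≤ m ^ (j + 1 + n + 1) := by
      rw [pow_succ, mul_assoc, show j + 1 + n + 1 = j + (n + 2) by ring, pow_add m j (n + 2)]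
      exact Ideal.mul_mono_right hmg
    exact h1 (Ideal.mul_mem_mul hr (Ideal.mem_span_singleton_self g))
  have h2 : f ∈ V n₀ := by
    rw [hn₀ (max n₀ (n + 1)) (le_max_left _ _)]
    exact V.monotone (le_max_right _ _) hf
  have h3 := h2 1 n hn
  rw [OneMemClass.coe_one, one_mul] at h3
  change (monomial n g).coeff n ∈ _ at h3
  rwa [coeff_monomial_same] at h3

/-- A polynomial whose coefficients generate `m` is a superficial element. -/
theorem exists_forall_mem_map_pow_succ {R : Type*} [CommRing R] [IsNoetherianRing R]
    {m : Ideal R} {a : R[X]} (ha : Ideal.span (Set.range a.coeff) = m) :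
    ∃ n₀, ∀ n ≥ n₀, ∀ g ∈ (m ^ n).map C, a * g ∈ (m ^ (n + 2)).map C →
      g ∈ (m ^ (n + 1)).map C := by
  obtain ⟨n₀, hn₀⟩ := exists_forall_mem_pow_succ m
  have ham (i) : a.coeff i ∈ m := ha ▸ Ideal.subset_span ⟨i, rfl⟩
  have haC : a ∈ m.map C := Ideal.mem_map_C_iff.2 ham
  suffices H : ∀ d n, n₀ ≤ n → ∀ g : R[X], (∀ k ≥ d, g.coeff k = 0) → g ∈ (m ^ n).map C →
      a * g ∈ (m ^ (n + 2)).map C → g ∈ (m ^ (n + 1)).map C from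
    ⟨n₀, fun n hn g hg => H (g.natDegree + 1) n hn g
      (fun k hk => coeff_eq_zero_of_natDegree_lt hk) hg⟩
  intro d
  induction d with
  | zero =>
    intro n _ g hg _ _
    rw [show g = 0 from Polynomial.ext fun k => hg k (Nat.zero_le k)]
    exact zero_mem _
  | succ d ih =>
    intro n hn g hgd hg hag
    have hmul {y : R} (hy : y ∈ m) {k : ℕ} {f : R[X]} (hf : f ∈ (m ^ k).map C) :
        C y * f ∈ (m ^ (k + 1)).map C := by
      rw [pow_succ', Ideal.map_mul]
      exact Ideal.mul_mem_mul (Ideal.mem_map_of_mem _ hy) hf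
    have key : ∀ s i, a.natDegree < i + s → C (a.coeff i) * g ∈ (m ^ (n + 2)).map C := by
      intro s
      induction s with
      | zero =>
        intro i hi
        rw [coeff_eq_zero_of_natDegree_lt (by omega), C_0, zero_mul]
        exact zero_mem _
      | succ s ihs =>
        intro i hi
        have htop : a.coeff i * g.coeff d ∈ m ^ (n + 2) := by
          have h1 := Ideal.mem_map_C_iff.1 hag (i + d)
          rw [coeff_mul, ← Finset.add_sum_erase _ _
            (Finset.HasAntidiagonal.mem_antidiagonal.2 rfl :
              (i, d) ∈ Finset.HasAntidiagonal.antidiagonal (i + d))] at h1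
          refine (Ideal.add_mem_iff_left _ (Ideal.sum_mem _ fun p hp => ?_)).1 h1
          rw [Finset.mem_erase, Finset.HasAntidiagonal.mem_antidiagonal] at hp
          rcases lt_trichotomy p.1 i with h2 | h2 | h2
          · rw [hgd p.2 (by omega), mul_zero]
            exact zero_mem _
          · exact absurd (Prod.ext h2 (by change p.2 = d; omega)) hp.1
          · have h3 := Ideal.mem_map_C_iff.1 (ihs p.1 (by omega)) p.2
            rwa [coeff_C_mul] at h3
        have hmon : monomial d (a.coeff i * g.coeff d) ∈ (m ^ (n + 2)).map C := by
          rw [← C_mul_X_pow_eq_monomial]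
          exact Ideal.mul_mem_right _ _ (Ideal.mem_map_of_mem _ htop)
        rw [← sub_add_cancel (C (a.coeff i) * g) (monomial d (a.coeff i * g.coeff d))]
        refine Ideal.add_mem _ (ih (n + 1) (by omega) _ (fun k hk => ?_) ?_ ?_) hmon
        · rw [coeff_sub, coeff_C_mul, coeff_monomial]
          split_ifs with h
          · rw [h, sub_self]
          · rw [hgd k (by omega), mul_zero, sub_zero]
        · exact Ideal.sub_mem _ (hmul (ham i) hg)
            (Ideal.map_mono (Ideal.pow_le_pow_right (by omega)) hmon)
        · rw [mul_sub, mul_left_comm]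
          refine Ideal.sub_mem _ (hmul (ham i) hag) ?_
          rw [show n + 1 + 2 = 1 + (n + 2) by ring, pow_add, pow_one, Ideal.map_mul]
          exact Ideal.mul_mem_mul haC hmon
    rw [Ideal.mem_map_C_iff]
    intro k
    refine hn₀ n hn _ (Ideal.mem_map_C_iff.1 hg k) fun y hy => ?_
    rw [← ha] at hy
    induction hy using Submodule.span_induction with
    | mem y hy =>
      obtain ⟨i, rfl⟩ := hy
      have h3 := Ideal.mem_map_C_iff.1 (key (a.natDegree + 1) i (by omega)) k
      rwa [coeff_C_mul] at h3
    | zero => simp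
    | add y z _ _ hy hz =>
      rw [add_mul]
      exact Ideal.add_mem _ hy hz
    | smul c y _ hy =>
      rw [smul_eq_mul, mul_assoc]
      exact Ideal.mul_mem_left _ _ hy

end Superficial

section MinimalGenerators

variable {R : Type*} [CommRing R] [IsLocalRing R] [IsNoetherianRing R]

theorem exists_span_range_eq_pow (n : ℕ) :
    ∃ (r : ℕ) (g : Fin r → R), Ideal.span (Set.range g) = maximalIdeal R ^ n ∧
      (∀ c : Fin r → R, ∑ j, c j * g j ∈ maximalIdeal R ^ (n + 1) → ∀ j, c j ∈ maximalIdeal R) ∧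
      Module.length R (R ⧸ maximalIdeal R ^ (n + 1)) =
        Module.length R (R ⧸ maximalIdeal R ^ n) + r := by
  classical
  obtain ⟨r, π, x, hπ, hx⟩ := exists_dual_system (S := R) (M := ↥(maximalIdeal R ^ n))
  let Φ : ↥(maximalIdeal R ^ n) →ₗ[R] Fin r → R ⧸ maximalIdeal R := LinearMap.pi π
  have hspan : Ideal.span (Set.range fun j => (x j : R)) = maximalIdeal R ^ n := by
    have := congrArg (Submodule.map (maximalIdeal R ^ n).subtype) hx
    rwa [Submodule.map_span, Submodule.map_top, Submodule.range_subtype, ← Set.range_comp] at this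
  have hΦx (c : Fin r → R) (i) : Φ (∑ j, c j • x j) i = Ideal.Quotient.mk _ (c i) := by
    change π i _ = _
    rw [map_sum]
    simp_rw [map_smul, hπ]
    simp [Algebra.smul_def]
  have hΦsurj : Function.Surjective Φ := fun w => by
    choose c hc using fun i => Ideal.Quotient.mk_surjective (w i)
    exact ⟨∑ j, c j • x j, funext fun i => (hΦx c i).trans (hc i)⟩
  have hker : LinearMap.ker Φ =
      LinearMap.ker (Submodule.mkQ (maximalIdeal R ^ (n + 1)) ∘ₗ (maximalIdeal R ^ n).subtype) := by
    ext v
    rw [LinearMap.mem_ker, LinearMap.mem_ker, LinearMap.comp_apply, Submodule.mkQ_apply,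
      Submodule.Quotient.mk_eq_zero]
    constructor
    · intro hv
      obtain ⟨c, rfl⟩ := (Submodule.mem_span_range_iff_exists_fun R).1
        (hx ▸ Submodule.mem_top : v ∈ Submodule.span R (Set.range x))
      rw [map_sum]
      refine Ideal.sum_mem _ fun j _ => ?_
      rw [pow_succ']
      refine Ideal.mul_mem_mul (Ideal.Quotient.eq_zero_iff_mem.1 ?_) (x j).2
      rw [← hΦx c, hv]
      rfl
    · intro hv
      change (v : R) ∈ _ at hv
      rw [pow_succ', ← smul_eq_mul] at hv
      have hv' : v ∈ maximalIdeal R • (⊤ : Submodule R ↥(maximalIdeal R ^ n)) := by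
        rw [Submodule.mem_smul_top_iff]
        exact hv
      clear hv
      induction hv' using Submodule.smul_induction_on' with
      | smul y hy u _ =>
        ext i
        change π i (y • u) = 0
        rw [map_smul]
        obtain ⟨t, ht⟩ := Ideal.Quotient.mk_surjective (π i u)
        rw [← ht]
        exact Ideal.Quotient.eq_zero_iff_mem.2 (Ideal.mul_mem_right _ _ hy)
      | add u _ w _ hu hw =>
        rw [map_add, hu, hw, add_zero]
  refine ⟨r, fun j => x j, hspan, fun c hc j => ?_, ?_⟩
  · have h1 : ∑ j, c j • x j ∈ LinearMap.ker Φ := by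
      rw [hker, LinearMap.mem_ker, LinearMap.comp_apply, Submodule.mkQ_apply,
        Submodule.Quotient.mk_eq_zero, map_sum]
      exact hc
    rw [← Ideal.Quotient.eq_zero_iff_mem, ← hΦx c, LinearMap.mem_ker.1 h1]
    rfl
  · let f := Submodule.mkQ (maximalIdeal R ^ (n + 1)) ∘ₗ (maximalIdeal R ^ n).subtype
    have hle : maximalIdeal R ^ (n + 1) ≤ maximalIdeal R ^ n := Ideal.pow_le_pow_right n.le_succ
    have h1 : Module.length R (LinearMap.range f) = r := by
      rw [← (f.quotKerEquivRange).length_eq, ← hker,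
        (Φ.quotKerEquivOfSurjective hΦsurj).length_eq, Module.length_pi_of_fintype]
      have : IsSimpleModule R (R ⧸ maximalIdeal R) :=
        isSimpleModule_iff_isCoatom.2 (maximalIdeal.isMaximal R).out
      simp
    rw [← h1, add_comm (Module.length R (R ⧸ maximalIdeal R ^ n))]
    refine Module.length_eq_add_of_exact (LinearMap.range f).subtype (Submodule.factor hle)
      (Submodule.injective_subtype _) (Submodule.factor_surjective hle) fun v => ?_
    obtain ⟨v, rfl⟩ := Submodule.Quotient.mk_surjective _ v
    rw [← Submodule.mkQ_apply, Submodule.factor_mk, Submodule.mkQ_apply,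
      Submodule.Quotient.mk_eq_zero]
    constructor
    · intro hv
      exact ⟨⟨f ⟨v, hv⟩, ⟨v, hv⟩, rfl⟩, rfl⟩
    · rintro ⟨⟨_, u, rfl⟩, hu⟩
      have h2 : (u : R) - v ∈ maximalIdeal R ^ (n + 1) := by
        rw [← Submodule.Quotient.mk_eq_zero, Submodule.Quotient.mk_sub, sub_eq_zero]
        exact hu
      rw [← sub_sub_cancel (u : R) v]
      exact Ideal.sub_mem _ u.2 (hle h2)

theorem length_quotient_maximalIdeal_pow_ne_top (n : ℕ) :
    Module.length R (R ⧸ maximalIdeal R ^ n) ≠ ⊤ := by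
  induction n with
  | zero =>
    have : Subsingleton (R ⧸ maximalIdeal R ^ 0) := by
      rw [Submodule.Quotient.subsingleton_iff, pow_zero, Ideal.one_eq_top]
    rw [Module.length_eq_zero]
    exact ENat.zero_ne_top
  | succ n ih =>
    obtain ⟨r, -, -, -, h⟩ := exists_span_range_eq_pow (R := R) n
    rw [h]
    exact WithTop.add_ne_top.2 ⟨ih, ENat.natCast_ne_top r⟩

theorem exists_span_range_eq_pow_of_length_eq {n e : ℕ}
    (he : Module.length R (R ⧸ maximalIdeal R ^ (n + 1)) =
      Module.length R (R ⧸ maximalIdeal R ^ n) + e) :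
    ∃ g : Fin e → R, Ideal.span (Set.range g) = maximalIdeal R ^ n ∧
      ∀ c : Fin e → R, ∑ j, c j * g j ∈ maximalIdeal R ^ (n + 1) →
        ∀ j, c j ∈ maximalIdeal R := by
  obtain ⟨r, g, hg, hc, h⟩ := exists_span_range_eq_pow (R := R) n
  rw [h] at he
  obtain rfl : r = e :=
    ENat.natCast_inj.1 (ENat.add_right_injective_of_ne_top
      (length_quotient_maximalIdeal_pow_ne_top n) he)
  exact ⟨g, hg, hc⟩

end MinimalGenerators

section Determinant

open Polynomial Matrix

theorem mem_map_C_iff_map_eq_zero {R : Type*} [CommRing R] {m : Ideal R} {f : R[X]} :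
    f ∈ m.map C ↔ f.map (Ideal.Quotient.mk m) = 0 := by
  simp [Ideal.mem_map_C_iff, Polynomial.ext_iff, Ideal.Quotient.eq_zero_iff_mem]

theorem exists_forall_exists_mul_eq {R : Type*} [CommRing R] {m : Ideal R} [m.IsPrime] {a : R[X]}
    (ha : a ∈ m.map C) {n e : ℕ}
    (hinj : ∀ g ∈ (m ^ n).map C, a * g ∈ (m ^ (n + 2)).map C → g ∈ (m ^ (n + 1)).map C)
    {g h : Fin e → R} (hg : Ideal.span (Set.range g) = m ^ n)
    (hgc : ∀ c : Fin e → R, ∑ j, c j * g j ∈ m ^ (n + 1) → ∀ j, c j ∈ m)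
    (hh : Ideal.span (Set.range h) = m ^ (n + 1)) :
    ∃ p : R[X], p ∉ m.map C ∧ ∀ f ∈ (m ^ (n + 1)).map C, ∃ f' ∈ (m ^ n).map C, p * f = a * f' := by
  let gv : Fin e → R[X] := fun j => C (g j)
  let hv : Fin e → R[X] := fun j => C (h j)
  have hgv : (m ^ n).map C = Ideal.span (Set.range gv) := by
    rw [← hg, Ideal.map_span, ← Set.range_comp]
    rfl
  have hhv : (m ^ (n + 1)).map C = Ideal.span (Set.range hv) := by
    rw [← hh, Ideal.map_span, ← Set.range_comp]
    rfl
  have hgmem (v : Fin e → R[X]) : v ⬝ᵥ gv ∈ (m ^ n).map C :=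
    Ideal.sum_mem _ fun j _ => Ideal.mul_mem_left _ _ (hgv ▸ Ideal.subset_span ⟨j, rfl⟩)
  have hA (j) : ∃ c : Fin e → R[X], c ⬝ᵥ hv = a * gv j := by
    have h1 : a * gv j ∈ Ideal.span (Set.range hv) := by
      rw [← hhv, pow_succ', Ideal.map_mul]
      exact Ideal.mul_mem_mul ha (hgv ▸ Ideal.subset_span ⟨j, rfl⟩)
    exact Ideal.mem_span_range_iff_exists_fun.1 h1
  choose A hA using hA
  have hAv : Matrix.of A *ᵥ hv = a • gv := funext hA
  refine ⟨(Matrix.of A).det, fun hdet => ?_, fun f hf => ?_⟩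
  · have h0 : ((Matrix.of A).map (mapRingHom (Ideal.Quotient.mk m))).det = 0 := by
      rw [← RingHom.mapMatrix_apply, ← RingHom.map_det]
      exact mem_map_C_iff_map_eq_zero.1 hdet
    obtain ⟨w, hw0, hw⟩ := Matrix.exists_vecMul_eq_zero_iff.2 h0
    choose v hv' using fun j => map_surjective _ Ideal.Quotient.mk_surjective (w j)
    have h1 : v ⬝ᵥ gv ∈ (m ^ (n + 1)).map C := by
      refine hinj _ (hgmem v) ?_
      have h2 : a * v ⬝ᵥ gv = (v ᵥ* Matrix.of A) ⬝ᵥ hv := by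
        rw [← dotProduct_mulVec, hAv, dotProduct_smul, smul_eq_mul]
      rw [h2, show n + 2 = 1 + (n + 1) by ring, pow_add, pow_one, Ideal.map_mul]
      refine Ideal.sum_mem _ fun j _ => Ideal.mul_mem_mul ?_ (hhv ▸ Ideal.subset_span ⟨j, rfl⟩)
      rw [mem_map_C_iff_map_eq_zero]
      have h3 := congrFun hw j
      rw [Pi.zero_apply] at h3
      rw [← h3]
      simp only [vecMul, dotProduct, Polynomial.map_sum, Polynomial.map_mul, hv']
      rfl
    refine hw0 (funext fun j => ?_)
    rw [← hv', Pi.zero_apply, ← mem_map_C_iff_map_eq_zero, Ideal.mem_map_C_iff]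
    intro k
    refine hgc (fun j => (v j).coeff k) ?_ j
    have h4 := Ideal.mem_map_C_iff.1 h1 k
    simpa [dotProduct, finsetSum_coeff, gv] using h4
  · rw [hhv] at hf
    obtain ⟨c, rfl⟩ : ∃ c : Fin e → R[X], c ⬝ᵥ hv = f := Ideal.mem_span_range_iff_exists_fun.1 hf
    refine ⟨(c ᵥ* (Matrix.of A).adjugate) ⬝ᵥ gv, hgmem _, ?_⟩
    have h1 : (Matrix.of A).adjugate *ᵥ (a • gv) = (Matrix.of A).det • hv := by
      rw [← hAv, mulVec_mulVec, adjugate_mul, smul_mulVec, one_mulVec]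
    rw [← dotProduct_mulVec, ← smul_eq_mul, ← dotProduct_smul, ← h1, mulVec_smul, dotProduct_smul,
      smul_eq_mul]

end Determinant

section Extension

open Polynomial

variable {R : Type u} [CommRing R] [IsLocalRing R]

theorem isMaximal_map_algebraMap_adjoinRoot {F : R[X]}
    (hirr : Irreducible (F.map (Ideal.Quotient.mk (maximalIdeal R)))) :
    ((maximalIdeal R).map (algebraMap R (AdjoinRoot F))).IsMaximal := by
  let _ := Ideal.Quotient.field (maximalIdeal R)
  have hmem (y) : y ∈ (maximalIdeal R).map (algebraMap R (AdjoinRoot F)) ↔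
      ∃ g ∈ (maximalIdeal R).map C, AdjoinRoot.mk F g = y := by
    rw [← Ideal.mem_map_iff_of_surjective _ AdjoinRoot.mk_surjective, Ideal.map_map]
    rfl
  rw [Ideal.isMaximal_iff]
  constructor
  · rw [hmem]
    rintro ⟨g, hg, hg1⟩
    rw [← map_one (AdjoinRoot.mk F), AdjoinRoot.mk_eq_mk] at hg1
    obtain ⟨h, hh⟩ := hg1
    have h1 := congrArg (Polynomial.map (Ideal.Quotient.mk (maximalIdeal R))) hh
    rw [Polynomial.map_sub, mem_map_C_iff_map_eq_zero.1 hg, Polynomial.map_mul, Polynomial.map_one,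
      zero_sub] at h1
    exact hirr.not_isUnit (isUnit_of_dvd_unit ⟨_, h1⟩ isUnit_one.neg)
  · intro J y hJ hy hyJ
    obtain ⟨g, rfl⟩ := AdjoinRoot.mk_surjective y
    have hcop : IsCoprime (F.map (Ideal.Quotient.mk (maximalIdeal R)))
        (g.map (Ideal.Quotient.mk (maximalIdeal R))) := by
      refine (hirr.coprime_iff_not_dvd).2 ?_
      rintro ⟨h, hh⟩
      obtain ⟨h, rfl⟩ := map_surjective _ Ideal.Quotient.mk_surjective h
      refine hy ((hmem _).2 ⟨g - F * h, ?_, ?_⟩)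
      · rw [mem_map_C_iff_map_eq_zero, Polynomial.map_sub, Polynomial.map_mul, hh, sub_self]
      · simp
    obtain ⟨s, t, hst⟩ := hcop
    obtain ⟨s, rfl⟩ := map_surjective _ Ideal.Quotient.mk_surjective s
    obtain ⟨t, rfl⟩ := map_surjective _ Ideal.Quotient.mk_surjective t
    have h1 : AdjoinRoot.mk F (s * F + t * g - 1) ∈ J := by
      refine hJ ((hmem _).2 ⟨_, ?_, rfl⟩)
      rw [mem_map_C_iff_map_eq_zero, Polynomial.map_sub, Polynomial.map_add, Polynomial.map_mul,
        Polynomial.map_mul, hst, Polynomial.map_one, sub_self]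
    have h2 : AdjoinRoot.mk F (t * g) ∈ J := by
      rw [map_mul]
      exact Ideal.mul_mem_left _ _ hyJ
    rw [map_sub, map_add, map_mul, AdjoinRoot.mk_self, mul_zero, zero_add, map_one] at h1
    simpa using J.sub_mem h2 h1

theorem eq_map_algebraMap_of_isMaximal {A : Type*} [CommRing A] [Algebra R A]
    [Algebra.IsIntegral R A] (h : ((maximalIdeal R).map (algebraMap R A)).IsMaximal)
    {P : Ideal A} (hP : P.IsMaximal) : P = (maximalIdeal R).map (algebraMap R A) := by
  have h1 := Ideal.isMaximal_comap_of_isIntegral_of_isMaximal (R := R) P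
  refine (h.eq_of_le hP.ne_top ?_).symm
  rw [Ideal.map_le_iff_le_comap]
  exact (IsLocalRing.eq_maximalIdeal h1).ge

/-- After a finite free local extension with the same maximal ideal, a polynomial outside of
`m[X]` has an invertible value. -/
theorem exists_local_extension {p : R[X]} (hp : p ∉ (maximalIdeal R).map C) :
    ∃ F : R[X], F.Monic ∧ ∃ _ : IsLocalRing (AdjoinRoot F),
      maximalIdeal (AdjoinRoot F) = (maximalIdeal R).map (algebraMap R (AdjoinRoot F)) ∧
      IsUnit (AdjoinRoot.mk F p) := by
  let _ := Ideal.Quotient.field (maximalIdeal R)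
  rw [mem_map_C_iff_map_eq_zero] at hp
  set q := p.map (Ideal.Quotient.mk (maximalIdeal R)) with hq
  have hdeg : (1 + X * q).natDegree ≠ 0 := by
    rw [add_comm, ← C_1, natDegree_add_C, natDegree_X_mul hp]
    exact Nat.succ_ne_zero _
  obtain ⟨f, hfm, hfi, hfd⟩ := exists_monic_irreducible_factor (1 + X * q)
    (not_isUnit_of_natDegree_pos _ (Nat.pos_of_ne_zero hdeg))
  obtain ⟨F, hF, -, hFm⟩ := lifts_and_natDegree_eq_and_monic
    (f := Ideal.Quotient.mk (maximalIdeal R)) (p := f)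
    (map_surjective _ Ideal.Quotient.mk_surjective f) hfm
  rw [← hF] at hfi hfd
  have hmax := isMaximal_map_algebraMap_adjoinRoot hfi
  have := hFm.finite_adjoinRoot
  have huniq (P : Ideal (AdjoinRoot F)) (hP : P.IsMaximal) := eq_map_algebraMap_of_isMaximal hmax hP
  have hloc : IsLocalRing (AdjoinRoot F) := .of_unique_max_ideal ⟨_, hmax, huniq⟩
  refine ⟨F, hFm, hloc, huniq _ (maximalIdeal.isMaximal _), ?_⟩
  by_contra hnu
  rw [← mem_nonunits_iff, ← mem_maximalIdeal, huniq _ (maximalIdeal.isMaximal _)] at hnu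
  have h1 : (AdjoinRoot.mk F p) ∈ ((maximalIdeal R).map C).map (AdjoinRoot.mk F) := by
    rw [Ideal.map_map]
    exact hnu
  obtain ⟨g, hg, hgp⟩ := (Ideal.mem_map_iff_of_surjective _ AdjoinRoot.mk_surjective).1 h1
  rw [AdjoinRoot.mk_eq_mk] at hgp
  obtain ⟨h, hh⟩ := hgp
  have h2 := congrArg (Polynomial.map (Ideal.Quotient.mk (maximalIdeal R))) hh
  rw [Polynomial.map_sub, mem_map_C_iff_map_eq_zero.1 hg, Polynomial.map_mul, ← hq, zero_sub] at h2
  have h3 : F.map (Ideal.Quotient.mk (maximalIdeal R)) ∣ q := (dvd_neg).1 ⟨_, h2⟩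
  exact hfi.not_isUnit (isUnit_of_dvd_one
    ((dvd_add_left (h3.mul_left X)).1 hfd))

/-- If `m ^ (n + 1) = α m ^ n` and `m ^ n` is generated by `e` elements, then `A / α A` has length
at most `e`. -/
theorem length_quotient_span_singleton_le {A : Type*} [CommRing A] [IsLocalRing A] {α X : A}
    {n e : ℕ} (hred : ∀ y ∈ maximalIdeal A ^ (n + 1), ∃ w ∈ maximalIdeal A ^ n, α * w = y)
    (hα : α ∈ nonZeroDivisors A) (hXn : X ∈ maximalIdeal A ^ n)
    (hlenX : Module.length A (A ⧸ Ideal.span {X}) ≠ ⊤) {g : Fin e → A}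
    (hg : Ideal.span (Set.range g) = maximalIdeal A ^ n) :
    Module.length A (A ⧸ Ideal.span {α}) ≤ e := by
  have hlen := length_quotSMulTop_ideal (ι := Submodule.subtype (maximalIdeal A ^ n))
    (X := ⟨X, hXn⟩) (Submodule.injective_subtype _) hα hlenX
  rw [← hlen]
  have hgA (j : Fin e) : g j ∈ maximalIdeal A ^ n := hg ▸ Ideal.subset_span ⟨j, rfl⟩
  let γ (j : Fin e) : QuotSMulTop α ↥(maximalIdeal A ^ n) := Submodule.Quotient.mk ⟨_, hgA j⟩
  have hγ (j) : maximalIdeal A ≤ LinearMap.ker (LinearMap.toSpanSingleton A _ (γ j)) := by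
    intro y hy
    rw [LinearMap.mem_ker, LinearMap.toSpanSingleton_apply, ← Submodule.Quotient.mk_smul,
      QuotSMulTop.mk_eq_zero_iff]
    obtain ⟨w, hw, hyw⟩ := hred (y * g j) (by
      rw [pow_succ']
      exact Ideal.mul_mem_mul hy (hgA j))
    exact ⟨⟨w, hw⟩, Subtype.ext hyw⟩
  let Ψ : (Fin e → A ⧸ maximalIdeal A) →ₗ[A] QuotSMulTop α ↥(maximalIdeal A ^ n) :=
    ∑ j, (Submodule.liftQ (maximalIdeal A) (LinearMap.toSpanSingleton A _ (γ j)) (hγ j)) ∘ₗ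
      LinearMap.proj j
  have hΨ : Function.Surjective Ψ := by
    intro w
    obtain ⟨⟨w, hw⟩, rfl⟩ := Submodule.Quotient.mk_surjective _ w
    obtain ⟨c, hc⟩ := Ideal.mem_span_range_iff_exists_fun.1 (hg.ge hw)
    refine ⟨fun j => Submodule.Quotient.mk (c j), ?_⟩
    have h1 : (⟨w, hw⟩ : ↥(maximalIdeal A ^ n)) = ∑ j, c j • ⟨_, hgA j⟩ := by
      refine Subtype.ext (hc.symm.trans ?_)
      simp
    rw [h1, ← Submodule.mkQ_apply, map_sum, LinearMap.sum_apply]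
    exact Finset.sum_congr rfl fun j _ => rfl
  refine (Module.length_le_of_surjective Ψ hΨ).trans ?_
  have : IsSimpleModule A (A ⧸ maximalIdeal A) :=
    isSimpleModule_iff_isCoatom.2 (maximalIdeal.isMaximal A).out
  rw [Module.length_pi_of_fintype]
  simp

variable [IsNoetherianRing R]

theorem exists_extension_of_isMultiplicityAt [Ring.KrullDimLE 1 R] {x : R}
    (hxm : x ∈ maximalIdeal R) (hx : x ∈ nonZeroDivisors R) {e : ℕ}
    (he : IsMultiplicityAt R (maximalIdeal R) e) :
    ∃ (A : Type u) (_ : CommRing A) (_ : IsLocalRing A) (_ : Algebra R A) (_ : Module.Free R A)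
      (_ : Module.Finite R A) (a : A),
      maximalIdeal A = (maximalIdeal R).map (algebraMap R A) ∧ a ∈ maximalIdeal A ∧
      a ∈ nonZeroDivisors A ∧ Module.length A (A ⧸ Ideal.span {a}) ≤ e := by
  obtain ⟨s, z, hz⟩ := Submodule.fg_iff_exists_fin_generating_family.1
    (IsNoetherian.noetherian (maximalIdeal R))
  let a : R[X] := ∑ i : Fin s, monomial i (z i)
  have hac (i : Fin s) : a.coeff i = z i := by
    simp [a, finsetSum_coeff, coeff_monomial, Fin.val_inj]
  have haC : a ∈ (maximalIdeal R).map C := by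
    refine Ideal.sum_mem _ fun i _ => ?_
    rw [← C_mul_X_pow_eq_monomial]
    exact Ideal.mul_mem_right _ _ (Ideal.mem_map_of_mem _ (hz ▸ Submodule.subset_span ⟨i, rfl⟩))
  have ha : Ideal.span (Set.range a.coeff) = maximalIdeal R := by
    refine le_antisymm (Ideal.span_le.2 ?_) ?_
    · rintro _ ⟨k, rfl⟩
      exact Ideal.mem_map_C_iff.1 haC k
    · rw [← hz]
      refine Submodule.span_mono ?_
      rintro _ ⟨i, rfl⟩
      exact ⟨i, hac i⟩
  obtain ⟨n₀, hn₀⟩ := exists_forall_mem_map_pow_succ ha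
  obtain ⟨N, hN⟩ := he
  simp only [moduleLength, ← Module.length_eq_height] at hN
  let n := max n₀ N
  obtain ⟨g, hg, hgc⟩ := exists_span_range_eq_pow_of_length_eq (hN n (le_max_right _ _))
  obtain ⟨h, hh, -⟩ := exists_span_range_eq_pow_of_length_eq
    (hN (n + 1) ((le_max_right _ _).trans n.le_succ))
  obtain ⟨p, hp, hpm⟩ := exists_forall_exists_mul_eq haC (hn₀ n (le_max_left _ _)) hg hgc hh
  obtain ⟨F, hFm, hloc, hmax, hunit⟩ := exists_local_extension hp
  let A := AdjoinRoot F
  have : Module.Free R A := hFm.free_adjoinRoot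
  have : Module.Finite R A := hFm.finite_adjoinRoot
  let α : A := AdjoinRoot.mk F a
  have hpow (k : ℕ) : maximalIdeal A ^ k =
      ((maximalIdeal R ^ k).map C).map (AdjoinRoot.mk F) := by
    rw [hmax, ← Ideal.map_pow, Ideal.map_map]
    rfl
  have hred (y : A) (hy : y ∈ maximalIdeal A ^ (n + 1)) :
      ∃ w ∈ maximalIdeal A ^ n, α * w = y := by
    rw [hpow] at hy
    obtain ⟨f, hf, rfl⟩ := (Ideal.mem_map_iff_of_surjective _ AdjoinRoot.mk_surjective).1 hy
    obtain ⟨f', hf', hff'⟩ := hpm f hf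
    obtain ⟨ε, hε⟩ := hunit
    refine ⟨↑ε⁻¹ * AdjoinRoot.mk F f', Ideal.mul_mem_left _ _ ?_, ?_⟩
    · rw [hpow]
      exact Ideal.mem_map_of_mem _ hf'
    · rw [mul_left_comm, ← map_mul, ← hff', map_mul, ← hε, Units.inv_mul_cancel_left]
  have hxA (k : ℕ) : algebraMap R A (x ^ k) ∈ nonZeroDivisors A :=
    algebraMap_mem_nonZeroDivisors_of_flat (pow_mem hx k)
  have hxpow (k : ℕ) : algebraMap R A (x ^ k) ∈ maximalIdeal A ^ k := by
    rw [map_pow, hmax]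
    exact Ideal.pow_mem_pow (Ideal.mem_map_of_mem _ hxm) k
  have hαm : α ∈ maximalIdeal A := by
    have := Ideal.mem_map_of_mem (AdjoinRoot.mk F) haC
    rwa [← pow_one (maximalIdeal R), ← hpow, pow_one] at this
  have hα : α ∈ nonZeroDivisors A := by
    obtain ⟨y, -, hy⟩ := hred _ (hxpow (n + 1))
    exact (mul_mem_nonZeroDivisors.1 (hy.symm ▸ hxA (n + 1))).1
  refine ⟨A, inferInstance, hloc, inferInstance, inferInstance, inferInstance, α, hmax, hαm, hα, ?_⟩
  refine length_quotient_span_singleton_le (g := fun j => AdjoinRoot.mk F (C (g j))) hred hα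
    (hxpow n) (Module.length_ne_top_iff.2 (isFiniteLength_quotient_span_algebraMap (A := A)
      (isFiniteLength_quotient_span_singleton R (pow_mem hx n)))) ?_
  rw [hpow, ← hg, Ideal.map_span, Ideal.map_span, ← Set.range_comp, ← Set.range_comp]
  rfl

end Extension

end

/-- (Theorem 1.4 (2)) Let `R` be a one-dimensional Cohen–Macaulay local ring
with canonical module `K` and `I` a faithful ideal such that `I ⊗_R Hom_R(I, K)` is
torsionfree. If `e(R) ≤ 6`, then `I ≅ R` or `I ≅ K` as an `R`-module. -/
theorem stmt5 (R : Type u) [CommRing R] [IsLocalRing R]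
    (hCM : IsOneDimCMLocal R)
    (K : Type u) [AddCommGroup K] [Module R K]
    (hK : IsCanonicalModuleAt R (IsLocalRing.maximalIdeal R) K)
    (I : Ideal R) (hfaith : Module.annihilator R ↥I = ⊥)
    (htf : Submodule.torsion R (↥I ⊗[R] (↥I →ₗ[R] K)) = ⊥)
    (he : ∃ e : ℕ, IsMultiplicityAt R (IsLocalRing.maximalIdeal R) e ∧ e ≤ 6) :
    Nonempty (↥I ≃ₗ[R] R) ∨ Nonempty (↥I ≃ₗ[R] K) := by
  obtain ⟨hN, hdim, p, hpm, hp⟩ := hCM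
  have : Ring.KrullDimLE 1 R := Ring.krullDimLE_iff.2 hdim.le
  obtain ⟨e, he, he6⟩ := he
  obtain ⟨x, hxI, hx⟩ : ((I : Set R) ∩ nonZeroDivisors R).Nonempty := by
    by_contra! h
    exact (Ideal.bot_lt_annihilator_of_disjoint_nonZeroDivisors
      (Set.disjoint_iff_inter_eq_empty.2 h)).ne' hfaith
  rcases eq_or_ne I ⊤ with rfl | hI
  · exact Or.inl ⟨Submodule.topEquiv⟩
  have hxm : x ∈ IsLocalRing.maximalIdeal R := IsLocalRing.le_maximalIdeal hI hxI
  obtain ⟨A, _, _, _, _, _, a, hmax, ham, ha, hlen⟩ :=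
    exists_extension_of_isMultiplicityAt hxm hx he
  rcases EndLiftsMod.exists_span_eq_top_or hmax ham ha (hlen.trans (by exact_mod_cast he6)) hxI hx
    (isFiniteLength_quotient_span_singleton R hx) (hK.endLiftsMod hxm hx hxI htf) with
    ⟨y, hy⟩ | hsoc
  · refine Or.inl ⟨(LinearEquiv.ofBijective (LinearMap.toSpanSingleton R I y) ⟨?_, ?_⟩).symm⟩
    · rw [injective_iff_map_eq_zero]
      intro r hr
      rw [← Submodule.mem_bot R, ← hfaith, ← Submodule.annihilator_top, ← hy,
        Submodule.mem_annihilator_span_singleton]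
      exact hr
    · rw [← LinearMap.range_eq_top, LinearMap.range_toSpanSingleton, hy]
  · exact Or.inr (hK.nonempty_linearEquiv hxm hx hxI hsoc)

end
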